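/- Let n ≥ 2, let g be a gauge function on ℝⁿ whose star-shaped body Q = {x : g(x) < 1} has smooth boundary with non-degenerate second fundamental form, and let f : ℝⁿ \ {0} → ℝ be smooth (C^∞) and homogeneous of degree 0. Then there is a constant C > 0 such that for all L ≥ 1, | Σ_{k ∈ ℤⁿ \ {0}, g(k) < √L} f(k) − L^{n/2} ∫_{Q} f(x) dx | ≤ C · L^{n/2 − n/(n+1)}. -/

import Mathlib

namespace LatticeCount

open MeasureTheory Measure Set Filter Topology Module
open scoped ContDiff

section FamilyBounds

variable {P X : Type*} [NormedAddCommGroup X] [NormedSpace ℝ X]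

/-- The derivative of a family of functions along a family of directions. -/
noncomputable def dirD (v : P → X) (a : P → X → ℝ) : P → X → ℝ :=
  fun p x => fderiv ℝ (a p) x (v p)

/-- The first `k` derivatives of `a p` along `v p` are bounded on `S p`, uniformly in `p`. -/
def UB (v : P → X) (S : P → Set X) : ℕ → (P → X → ℝ) → Prop
  | 0, a => ∃ M : ℝ, ∀ p, ∀ x ∈ S p, |a p x| ≤ M
  | k + 1, a => (∃ M : ℝ, ∀ p, ∀ x ∈ S p, |a p x| ≤ M) ∧ UB v S k (dirD v a)

variable {v : P → X} {S : P → Set X}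

theorem UB.bound {k : ℕ} {a : P → X → ℝ} (h : UB v S k a) :
    ∃ M : ℝ, ∀ p, ∀ x ∈ S p, |a p x| ≤ M := by
  cases k with
  | zero => exact h
  | succ k => exact h.1

theorem UB.pred {k : ℕ} {a : P → X → ℝ} (h : UB v S (k + 1) a) : UB v S k a := by
  induction k generalizing a with
  | zero => exact h.1
  | succ k ih => exact ⟨h.1, ih h.2⟩

theorem UB.congr (hS : ∀ p, IsOpen (S p)) {k : ℕ} {a b : P → X → ℝ}
    (hab : ∀ p, ∀ x ∈ S p, a p x = b p x) (h : UB v S k a) : UB v S k b := by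
  induction k generalizing a b with
  | zero =>
    obtain ⟨M, hM⟩ := h
    exact ⟨M, fun p x hx => by rw [← hab p x hx]; exact hM p x hx⟩
  | succ k ih =>
    obtain ⟨⟨M, hM⟩, h2⟩ := h
    refine ⟨⟨M, fun p x hx => by rw [← hab p x hx]; exact hM p x hx⟩, ih ?_ h2⟩
    intro p x hx
    have : a p =ᶠ[𝓝 x] b p := by
      filter_upwards [(hS p).mem_nhds hx] with y hy using hab p y hy
    simp only [dirD, this.fderiv_eq]

theorem differentiableAt_of_smoothOn (hS : ∀ p, IsOpen (S p)) {a : P → X → ℝ}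
    (ha : ∀ p, ContDiffOn ℝ ∞ (a p) (S p)) {p : P} {x : X} (hx : x ∈ S p) :
    DifferentiableAt ℝ (a p) x :=
  ((ha p).contDiffAt ((hS p).mem_nhds hx)).differentiableAt (by simp)

theorem smoothOn_dirD (hS : ∀ p, IsOpen (S p)) {a : P → X → ℝ}
    (ha : ∀ p, ContDiffOn ℝ ∞ (a p) (S p)) (p : P) : ContDiffOn ℝ ∞ (dirD v a p) (S p) :=
  ((ha p).fderiv_of_isOpen (hS p) (m := ∞) (by simp)).clm_apply contDiffOn_const

theorem UB.add (hS : ∀ p, IsOpen (S p)) {k : ℕ} {a b : P → X → ℝ}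
    (ha : ∀ p, ContDiffOn ℝ ∞ (a p) (S p)) (hb : ∀ p, ContDiffOn ℝ ∞ (b p) (S p))
    (hua : UB v S k a) (hub : UB v S k b) : UB v S k (fun p x => a p x + b p x) := by
  have key : ∀ {a b : P → X → ℝ}, (∃ M : ℝ, ∀ p, ∀ x ∈ S p, |a p x| ≤ M) →
      (∃ M : ℝ, ∀ p, ∀ x ∈ S p, |b p x| ≤ M) →
      ∃ M : ℝ, ∀ p, ∀ x ∈ S p, |a p x + b p x| ≤ M := by
    rintro a b ⟨M, hM⟩ ⟨M', hM'⟩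
    exact ⟨M + M', fun p x hx => (abs_add_le _ _).trans (add_le_add (hM p x hx) (hM' p x hx))⟩
  induction k generalizing a b with
  | zero => exact key hua hub
  | succ k ih =>
    refine ⟨key hua.1 hub.1, UB.congr hS ?_
      (ih (smoothOn_dirD hS ha) (smoothOn_dirD hS hb) hua.2 hub.2)⟩
    intro p x hx
    simp only [dirD]
    rw [fderiv_fun_add (differentiableAt_of_smoothOn hS ha hx)
      (differentiableAt_of_smoothOn hS hb hx)]
    rfl

theorem UB.mul (hS : ∀ p, IsOpen (S p)) {k : ℕ} {a b : P → X → ℝ}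
    (ha : ∀ p, ContDiffOn ℝ ∞ (a p) (S p)) (hb : ∀ p, ContDiffOn ℝ ∞ (b p) (S p))
    (hua : UB v S k a) (hub : UB v S k b) : UB v S k (fun p x => a p x * b p x) := by
  have key : ∀ {a b : P → X → ℝ}, (∃ M : ℝ, ∀ p, ∀ x ∈ S p, |a p x| ≤ M) →
      (∃ M : ℝ, ∀ p, ∀ x ∈ S p, |b p x| ≤ M) →
      ∃ M : ℝ, ∀ p, ∀ x ∈ S p, |a p x * b p x| ≤ M := by
    rintro a b ⟨M, hM⟩ ⟨M', hM'⟩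
    refine ⟨M * M', fun p x hx => ?_⟩
    rw [abs_mul]
    exact mul_le_mul (hM p x hx) (hM' p x hx) (abs_nonneg _) ((abs_nonneg _).trans (hM p x hx))
  induction k generalizing a b with
  | zero => exact key hua hub
  | succ k ih =>
    refine ⟨key hua.1 hub.1, UB.congr hS ?_
      (UB.add hS (fun p => (ha p).mul (smoothOn_dirD hS hb p))
        (fun p => (smoothOn_dirD hS ha p).mul (hb p))
        (ih ha (smoothOn_dirD hS hb) hua.pred hub.2)
        (ih (smoothOn_dirD hS ha) hb hua.2 hub.pred))⟩
    intro p x hx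
    simp only [dirD]
    rw [fderiv_fun_mul (differentiableAt_of_smoothOn hS ha hx)
      (differentiableAt_of_smoothOn hS hb hx)]
    simp [mul_comm]

theorem UB.const {k : ℕ} (c : ℝ) : UB v S k (fun _ _ => c) := by
  induction k generalizing c with
  | zero => exact ⟨|c|, fun p x hx => le_rfl⟩
  | succ k ih =>
    refine ⟨⟨|c|, fun p x hx => le_rfl⟩, ?_⟩
    have : dirD v (fun (_ : P) (_ : X) => c) = fun _ _ => 0 := by
      ext p x; simp [dirD]
    rw [this]; exact ih 0

theorem UB.inv (hS : ∀ p, IsOpen (S p)) {k : ℕ} {b : P → X → ℝ}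
    (hb : ∀ p, ContDiffOn ℝ ∞ (b p) (S p)) {c : ℝ} (hc : 0 < c)
    (hbc : ∀ p, ∀ x ∈ S p, c ≤ |b p x|)
    (hub : UB v S k b) : UB v S k (fun p x => (b p x)⁻¹) := by
  have h0 : ∀ p, ∀ x ∈ S p, b p x ≠ 0 := fun p x hx h => by
    have := hbc p x hx; rw [h, abs_zero] at this; linarith
  have hbnd : ∃ M : ℝ, ∀ p, ∀ x ∈ S p, |(b p x)⁻¹| ≤ M :=
    ⟨c⁻¹, fun p x hx => by rw [abs_inv]; exact inv_anti₀ hc (hbc p x hx)⟩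
  induction k with
  | zero => exact hbnd
  | succ k ih =>
    have hi := ih hub.pred
    have hsi : ∀ p, ContDiffOn ℝ ∞ (fun x => (b p x)⁻¹) (S p) := fun p => (hb p).inv (h0 p)
    refine ⟨hbnd, UB.congr hS ?_ (UB.mul hS (fun p => contDiffOn_const (c := (-1 : ℝ)))
      (fun p => ((hsi p).mul (hsi p)).mul (smoothOn_dirD hS hb p)) (UB.const (-1))
      (UB.mul hS (fun p => (hsi p).mul (hsi p)) (smoothOn_dirD hS hb)
        (UB.mul hS hsi hsi hi hi) hub.2))⟩
    intro p x hx
    have hd : HasFDerivAt (fun x => (b p x)⁻¹) _ x :=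
      (hasDerivAt_inv (h0 p x hx)).comp_hasFDerivAt x
        (differentiableAt_of_smoothOn hS hb hx).hasFDerivAt
    simp only [dirD]
    rw [hd.fderiv, _root_.smul_apply, smul_eq_mul]
    ring

end FamilyBounds

section NonStationary

variable {P X : Type*} [NormedAddCommGroup X] [NormedSpace ℝ X]

theorem fderiv_cexp_apply {φ : X → ℝ} {x : X} (h : DifferentiableAt ℝ φ x) (w : X) :
    fderiv ℝ (fun x => Complex.exp ((φ x : ℂ) * Complex.I)) x w
      = (fderiv ℝ φ x w : ℂ) * Complex.I * Complex.exp ((φ x : ℂ) * Complex.I) := by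
  have h1 : HasFDerivAt (fun x => ((φ x : ℂ) * Complex.I))
      ((Complex.ofRealCLM.comp (fderiv ℝ φ x)).smulRight Complex.I) x := by
    have := (Complex.ofRealCLM.hasFDerivAt.comp x h.hasFDerivAt).mul_const' Complex.I
    exact this
  have h2 := h1.cexp
  rw [h2.fderiv]
  simp
  ring

variable [FiniteDimensional ℝ X] [MeasurableSpace X] [BorelSpace X] {μ : Measure X}
  [μ.IsAddHaarMeasure]

theorem integral_ibp {a : X → ℝ} {φ : X → ℝ} (ha : ContDiff ℝ ∞ a) (hac : HasCompactSupport a)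
    (hφ : ContDiff ℝ ∞ φ) (w : X) :
    ∫ x, a x • ((fderiv ℝ φ x w : ℂ) * Complex.exp ((φ x : ℂ) * Complex.I)) ∂μ
      = Complex.I * ∫ x, fderiv ℝ a x w • Complex.exp ((φ x : ℂ) * Complex.I) ∂μ := by
  have hE : ContDiff ℝ ∞ (fun x => Complex.exp ((φ x : ℂ) * Complex.I)) :=
    ((Complex.ofRealCLM.contDiff.comp hφ).mul contDiff_const).cexp
  have hEd : Continuous fun x => fderiv ℝ (fun x => Complex.exp ((φ x : ℂ) * Complex.I)) x w :=
    (hE.continuous_fderiv (by simp)).clm_apply continuous_const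
  have had : Continuous fun x => fderiv ℝ a x w :=
    (ha.continuous_fderiv (by simp)).clm_apply continuous_const
  have key := integral_smul_fderiv_eq_neg_fderiv_smul_of_integrable (μ := μ) (𝕜 := ℝ)
    (f := a) (g := fun x => Complex.exp ((φ x : ℂ) * Complex.I)) (v := w)
    ((had.smul hE.continuous).integrable_of_hasCompactSupport
      ((hac.fderiv_apply ℝ w).smul_right))
    ((ha.continuous.smul hEd).integrable_of_hasCompactSupport hac.smul_right)
    ((ha.continuous.smul hE.continuous).integrable_of_hasCompactSupport hac.smul_right)
    (fun x _ => (ha.differentiable (by simp)) x) (fun x _ => (hE.differentiable (by simp)) x)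
  have hφd : ∀ x, DifferentiableAt ℝ φ x := fun x => (hφ.differentiable (by simp)) x
  simp_rw [fderiv_cexp_apply (hφd _)] at key
  have e1 : ∀ x, a x • ((fderiv ℝ φ x w : ℂ) * Complex.I * Complex.exp ((φ x : ℂ) * Complex.I))
      = Complex.I * (a x • ((fderiv ℝ φ x w : ℂ) * Complex.exp ((φ x : ℂ) * Complex.I))) := by
    intro x
    simp only [Complex.real_smul]
    ring
  simp_rw [e1] at key
  rw [integral_const_mul] at key
  have : ∀ z u : ℂ, Complex.I * z = -u → z = Complex.I * u := by
    intro z u h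
    have := congrArg (fun t => -Complex.I * t) h
    simp only [← mul_assoc] at this
    simpa using this
  exact this _ _ key

/-- Non-stationary phase for families: each integration by parts along `v p`
gains a factor `(κ p)⁻¹`. -/
theorem nonstationary_phase {v : P → X} {S : P → Set X} (hS : ∀ p, IsOpen (S p))
    {K : Set X} (hK : IsCompact K)
    {φ b : P → X → ℝ} {κ : P → ℝ} (hκ : ∀ p, 0 < κ p)
    (hφ : ∀ p, ContDiff ℝ ∞ (φ p)) (hb : ∀ p, ContDiff ℝ ∞ (b p))
    (hφb : ∀ p x, fderiv ℝ (φ p) x (v p) = κ p * b p x)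
    {c : ℝ} (hc : 0 < c) (hbc : ∀ p, ∀ x ∈ S p, c ≤ |b p x|)
    (hub : ∀ k, UB v S k b) (N : ℕ) :
    ∀ a : P → X → ℝ, (∀ p, ContDiff ℝ ∞ (a p)) → (∀ p, tsupport (a p) ⊆ S p) →
      (∀ p, tsupport (a p) ⊆ K) → (∀ k, UB v S k a) →
      ∃ C : ℝ, ∀ p, ‖∫ x, a p x • Complex.exp ((φ p x : ℂ) * Complex.I) ∂μ‖
        ≤ C * ((κ p)⁻¹) ^ N := by
  induction N with
  | zero =>
    intro a ha haS haK hua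
    obtain ⟨M, hM⟩ := hua 0
    refine ⟨max M 0 * μ.real K, fun p => ?_⟩
    rw [pow_zero, mul_one]
    rw [← setIntegral_eq_integral_of_forall_compl_eq_zero (s := K)]
    · refine norm_setIntegral_le_of_norm_le_const hK.measure_lt_top ?_
      intro x hx
      rw [norm_smul, Complex.norm_exp_ofReal_mul_I, mul_one, Real.norm_eq_abs]
      by_cases hxa : x ∈ tsupport (a p)
      · exact (hM p x (haS p hxa)).trans (le_max_left _ _)
      · rw [image_eq_zero_of_notMem_tsupport hxa, abs_zero]
        exact le_max_right _ _
    · intro x hx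
      rw [image_eq_zero_of_notMem_tsupport (fun h => hx (haK p h)), zero_smul]
  | succ N ih =>
    intro a ha haS haK hua
    have hb0 : ∀ p, ∀ x ∈ S p, b p x ≠ 0 := fun p x hx h => by
      have := hbc p x hx; rw [h, abs_zero] at this; linarith
    have hsd : ∀ p, ContDiff ℝ ∞ (fun x => a p x * (b p x)⁻¹) := by
      intro p
      rw [contDiff_iff_contDiffAt]
      intro x
      by_cases hx : x ∈ tsupport (a p)
      · exact (ha p).contDiffAt.mul ((hb p).contDiffAt.inv (hb0 p x (haS p hx)))
      · have : (fun x => a p x * (b p x)⁻¹) =ᶠ[𝓝 x] fun _ => 0 := by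
          have := notMem_tsupport_iff_eventuallyEq.1 hx
          filter_upwards [this] with y hy
          rw [hy]; simp
        exact contDiffAt_const.congr_of_eventuallyEq this
    have hts : ∀ p, tsupport (fun x => a p x * (b p x)⁻¹) ⊆ tsupport (a p) := fun p =>
      tsupport_mul_subset_left
    have hud : ∀ k, UB v S k (fun p x => a p x * (b p x)⁻¹) := fun k =>
      UB.mul hS (fun p => (ha p).contDiffOn) (fun p => (hb p).contDiffOn.inv (hb0 p)) (hua k)
        (UB.inv hS (fun p => (hb p).contDiffOn) hc hbc (hub k))
    have htd : ∀ p, tsupport (dirD v (fun p x => a p x * (b p x)⁻¹) p) ⊆ tsupport (a p) := by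
      intro p
      refine subset_trans ?_ (hts p)
      exact tsupport_fderiv_apply_subset ℝ (v p)
    obtain ⟨C, hC⟩ := ih (dirD v (fun p x => a p x * (b p x)⁻¹))
      (fun p => ((hsd p).fderiv_right (m := ∞) (by simp)).clm_apply contDiff_const)
      (fun p => (htd p).trans (haS p)) (fun p => (htd p).trans (haK p)) (fun k => (hud (k + 1)).2)
    refine ⟨C, fun p => ?_⟩
    have hcs : HasCompactSupport (fun x => a p x * (b p x)⁻¹) :=
      hK.of_isClosed_subset (isClosed_tsupport _) ((hts p).trans (haK p))
    have := integral_ibp (μ := μ) (hsd p) hcs (hφ p) (v p)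
    have e : ∀ x, (a p x * (b p x)⁻¹) • ((fderiv ℝ (φ p) x (v p) : ℂ) *
        Complex.exp ((φ p x : ℂ) * Complex.I))
        = (κ p : ℂ) * (a p x • Complex.exp ((φ p x : ℂ) * Complex.I)) := by
      intro x
      rw [hφb]
      by_cases hx : x ∈ tsupport (a p)
      · have hne : (b p x : ℂ) ≠ 0 := by exact_mod_cast hb0 p x (haS p hx)
        simp only [Complex.real_smul]
        push_cast
        field_simp
      · rw [image_eq_zero_of_notMem_tsupport hx]; simp
    simp_rw [e] at this
    rw [integral_const_mul] at this
    have h2 := congrArg norm this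
    rw [norm_mul, norm_mul, Complex.norm_I, one_mul, Complex.norm_real, Real.norm_eq_abs,
      abs_of_pos (hκ p)] at h2
    have h3 := hC p
    simp only [dirD] at h3
    rw [← h2] at h3
    rw [pow_succ, ← mul_assoc]
    rw [← div_eq_mul_inv, le_div_iff₀ (hκ p), mul_comm]
    exact h3

end NonStationary

section JointFamilies

variable {P W X : Type*} [NormedAddCommGroup X] [NormedSpace ℝ X]
  [NormedAddCommGroup W] [NormedSpace ℝ W]

theorem fderiv_slice {F : W × X → ℝ} (hF : ContDiff ℝ ∞ F) (w : W) (x τ v : X) :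
    fderiv ℝ (fun y => F (w, y + τ)) x v = fderiv ℝ F (w, x + τ) (0, v) := by
  have h1 : HasFDerivAt (fun y : X => (w, y + τ)) (ContinuousLinearMap.inr ℝ W X) x := by
    have := (hasFDerivAt_const (𝕜 := ℝ) w x).prodMk ((hasFDerivAt_id x).add_const τ)
    exact this
  have h2 := ((hF.differentiable (by simp)) (w, x + τ)).hasFDerivAt.comp x h1
  have h3 : fderiv ℝ (fun y => F (w, y + τ)) x = _ := h2.fderiv
  rw [h3]
  simp

theorem fderiv_slice' {F : W × X → ℝ} (hF : ContDiff ℝ ∞ F) (w : W) (x v : X) :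
    fderiv ℝ (fun y => F (w, y)) x v = fderiv ℝ F (w, x) (0, v) := by
  simpa using fderiv_slice hF w x 0 v

theorem contDiff_slice {F : W × X → ℝ} (hF : ContDiff ℝ ∞ F) (w : W) (τ : X) :
    ContDiff ℝ ∞ (fun y => F (w, y + τ)) :=
  hF.comp (contDiff_const.prodMk (contDiff_id.add contDiff_const))

theorem contDiff_dirDeriv {F : W × X → ℝ} (hF : ContDiff ℝ ∞ F) (V : W →L[ℝ] X) :
    ContDiff ℝ ∞ (fun y : W × X => fderiv ℝ F y (0, V y.1)) :=
  (hF.fderiv_right (m := ∞) (by simp)).clm_apply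
    (contDiff_const.prodMk (V.contDiff.comp contDiff_fst))

theorem UB.of_joint (V : W →L[ℝ] X) {L : Set (W × X)} (hL : IsCompact L) {w : P → W} {τ : P → X}
    {S : P → Set X} (hLS : ∀ p, ∀ x ∈ S p, (w p, x + τ p) ∈ L)
    {k : ℕ} {F : W × X → ℝ} (hF : ContDiff ℝ ∞ F) :
    UB (fun p => V (w p)) S k (fun p x => F (w p, x + τ p)) := by
  have key : ∀ {F : W × X → ℝ}, ContDiff ℝ ∞ F →
      ∃ M : ℝ, ∀ p, ∀ x ∈ S p, |F (w p, x + τ p)| ≤ M := by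
    intro F hF
    obtain ⟨M, hM⟩ := hL.exists_bound_of_continuousOn hF.continuous.continuousOn
    exact ⟨M, fun p x hx => hM _ (hLS p x hx)⟩
  induction k generalizing F with
  | zero => exact key hF
  | succ k ih =>
    refine ⟨key hF, ?_⟩
    have : dirD (fun p => V (w p)) (fun p x => F (w p, x + τ p))
        = fun p x => (fun y : W × X => fderiv ℝ F y (0, V y.1)) (w p, x + τ p) := by
      ext p x
      simp only [dirD]
      rw [fderiv_slice hF]
    rw [this]
    exact ih (contDiff_dirDeriv hF V)

theorem UB.differenceQuotient (V : W →L[ℝ] X) {L : Set W} (hL : IsCompact L) {B : Set X}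
    (hB : IsCompact B) (hBc : Convex ℝ B) {w : P → W} {h : P → X} (hh : ∀ p, h p ≠ 0)
    {S : P → Set X} (hw : ∀ p, w p ∈ L) (hS : ∀ p, ∀ x ∈ S p, x ∈ B ∧ x + h p ∈ B)
    {k : ℕ} {F : W × X → ℝ} (hF : ContDiff ℝ ∞ F) :
    UB (fun p => V (w p)) S k (fun p x => (F (w p, x + h p) - F (w p, x)) / ‖h p‖) := by
  have key : ∀ {F : W × X → ℝ}, ContDiff ℝ ∞ F →
      ∃ M : ℝ, ∀ p, ∀ x ∈ S p, |(F (w p, x + h p) - F (w p, x)) / ‖h p‖| ≤ M := by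
    intro F hF
    obtain ⟨M, hM⟩ := (hL.prod hB).exists_bound_of_continuousOn
      (hF.continuous_fderiv (by simp)).continuousOn
    refine ⟨M, fun p x hx => ?_⟩
    have hpos : 0 < ‖h p‖ := norm_pos_iff.2 (hh p)
    have hM0 : 0 ≤ M := (norm_nonneg _).trans (hM _ (mk_mem_prod (hw p) (hS p x hx).1))
    rw [abs_div, abs_norm, div_le_iff₀ hpos]
    have := Convex.norm_image_sub_le_of_norm_fderiv_le (𝕜 := ℝ) (f := fun y => F (w p, y))
      (s := B) (C := M) (x := x) (y := x + h p)
      (fun y _ => ((by simpa using contDiff_slice hF (w p) 0 :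
        ContDiff ℝ ∞ (fun y => F (w p, y))).differentiable (by simp)) y) ?_ hBc
        (hS p x hx).1 (hS p x hx).2
    · simpa using this
    · intro y hy
      refine ContinuousLinearMap.opNorm_le_bound _ hM0 fun u => ?_
      rw [fderiv_slice' hF]
      refine (ContinuousLinearMap.le_opNorm _ _).trans ?_
      have : ‖((0 : W), u)‖ = ‖u‖ := by simp [Prod.norm_def]
      rw [this]
      exact mul_le_mul_of_nonneg_right (hM _ (mk_mem_prod (hw p) hy)) (norm_nonneg _)
  induction k generalizing F with
  | zero => exact key hF
  | succ k ih =>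
    refine ⟨key hF, ?_⟩
    have : dirD (fun p => V (w p)) (fun p x => (F (w p, x + h p) - F (w p, x)) / ‖h p‖)
        = fun p x => ((fun y : W × X => fderiv ℝ F y (0, V y.1)) (w p, x + h p)
          - (fun y : W × X => fderiv ℝ F y (0, V y.1)) (w p, x)) / ‖h p‖ := by
      ext p x
      simp only [dirD, div_eq_mul_inv]
      have d1 := ((contDiff_slice hF (w p) (h p)).differentiable (by simp)) x
      have d2 : DifferentiableAt ℝ (fun y => F (w p, y)) x :=
        ((by simpa using contDiff_slice hF (w p) 0 :
          ContDiff ℝ ∞ (fun y => F (w p, y))).differentiable (by simp)) x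
      rw [fderiv_mul_const (d1.fun_sub d2), fderiv_fun_sub d1 d2]
      simp [fderiv_slice hF, fderiv_slice' hF, mul_comm]
    rw [this]
    exact ih (contDiff_dirDeriv hF V)

end JointFamilies

section Autocorrelation

variable {X : Type*} [NormedAddCommGroup X] [NormedSpace ℝ X] [FiniteDimensional ℝ X]
  [MeasurableSpace X] [BorelSpace X] {μ : Measure X} [μ.IsAddHaarMeasure]

theorem norm_integral_sq_le_autocorrelation {f : X → ℂ} (hf : Continuous f)
    (hfc : HasCompactSupport f) :
    ‖∫ x, f x ∂μ‖ ^ 2 ≤ ∫ h, ‖∫ x, f (x + h) * (starRingEnd ℂ) (f x) ∂μ‖ ∂μ := by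
  have hint : Integrable (Function.uncurry fun x h => f (x + h) * (starRingEnd ℂ) (f x))
      (μ.prod μ) := by
    apply Continuous.integrable_of_hasCompactSupport
    · simp only [Function.uncurry_def]
      fun_prop
    · refine HasCompactSupport.intro
        (K := (fun q : X × X => (q.1, q.2 - q.1)) '' (tsupport f ×ˢ tsupport f))
        ((hfc.isCompact.prod hfc.isCompact).image (by fun_prop)) ?_
      rintro ⟨x, h⟩ hx
      simp only [Function.uncurry_apply_pair]
      by_contra hne
      apply hx
      have h1 : f (x + h) ≠ 0 := left_ne_zero_of_mul hne
      have h2 : f x ≠ 0 := fun h0 => hne (by simp [h0])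
      exact ⟨(x, x + h), ⟨subset_tsupport f h2, subset_tsupport f h1⟩, by simp⟩
  have e : (∫ x, f x ∂μ) * (starRingEnd ℂ) (∫ x, f x ∂μ)
      = ∫ h, ∫ x, f (x + h) * (starRingEnd ℂ) (f x) ∂μ ∂μ := by
    rw [← integral_integral_swap hint, ← integral_conj, ← integral_const_mul]
    congr 1
    ext x
    rw [integral_mul_const, integral_add_left_eq_self f x]
  calc ‖∫ x, f x ∂μ‖ ^ 2 = ‖(∫ x, f x ∂μ) * (starRingEnd ℂ) (∫ x, f x ∂μ)‖ := by
        rw [norm_mul, RCLike.norm_conj, sq]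
    _ = ‖∫ h, ∫ x, f (x + h) * (starRingEnd ℂ) (f x) ∂μ ∂μ‖ := by rw [e]
    _ ≤ _ := norm_integral_le_integral_norm _

end Autocorrelation

section Oscillatory

variable {Z Y X : Type*} [NormedAddCommGroup X] [NormedSpace ℝ X] [FiniteDimensional ℝ X]
  [MeasurableSpace X] [BorelSpace X] {μ : Measure X} [μ.IsAddHaarMeasure]
  [NormedAddCommGroup Z] [NormedSpace ℝ Z] [NormedAddCommGroup Y] [NormedSpace ℝ Y]

open Module in
theorem oscillatory_of_hessian [Nontrivial X] {φ : Z × X → ℝ} {α : Y × X → ℝ} (hφ : ContDiff ℝ ∞ φ)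
    (hα : ContDiff ℝ ∞ α) {K : Set Z} (hK : IsCompact K)
    {T : Set Y} (hT : IsCompact T) {u : X} {r : ℝ}
    (hsupp : ∀ t ∈ T, tsupport (fun x => α (t, x)) ⊆ Metric.ball u r)
    {c : ℝ} (hc : 0 < c)
    (hnd : ∀ h : X, ∃ v : X, ‖v‖ ≤ 1 ∧ ∀ z ∈ K, ∀ x ∈ Metric.ball u r,
      c * ‖h‖ ≤ fderiv ℝ (fderiv ℝ φ) (z, x) (0, h) (0, v)) :
    ∃ C : ℝ, ∀ z ∈ K, ∀ t ∈ T, ∀ l : ℝ, 0 < l →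
      ‖∫ x, α (t, x) • Complex.exp (((l * φ (z, x) : ℝ) : ℂ) * Complex.I) ∂μ‖
        ≤ C * l ^ (-(finrank ℝ X : ℝ) / 2) := by
  choose dv hdv1 hdv using hnd
  let P := {q : Z × X × ℝ × Y // q.1 ∈ K ∧ q.2.1 ≠ 0 ∧ 0 < q.2.2.1 ∧ q.2.2.2 ∈ T}
  let w : P → Z × X := fun p => (p.1.1, dv p.1.2.1)
  let hh : P → X := fun p => p.1.2.1
  let lam : P → ℝ := fun p => p.1.2.2.1
  let w' : P → Y × X := fun p => (p.1.2.2.2, dv p.1.2.1)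
  let V : Z × X →L[ℝ] X := ContinuousLinearMap.snd ℝ Z X
  let V' : Y × X →L[ℝ] X := ContinuousLinearMap.snd ℝ Y X
  let B : Set X := Metric.closedBall u r
  have hBcp : IsCompact B := isCompact_closedBall u r
  let S : P → Set X := fun p => Metric.ball u r ∩ (fun x => x + hh p) ⁻¹' Metric.ball u r
  have hSo : ∀ p, IsOpen (S p) := fun p =>
    Metric.isOpen_ball.inter (Metric.isOpen_ball.preimage (by fun_prop))
  have hSB : ∀ p, ∀ x ∈ S p, x ∈ B ∧ x + hh p ∈ B := fun p x hx =>
    ⟨Metric.ball_subset_closedBall hx.1, Metric.ball_subset_closedBall hx.2⟩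
  let L : Set (Z × X) := K ×ˢ Metric.closedBall 0 1
  have hL : IsCompact L := hK.prod (isCompact_closedBall 0 1)
  have hwL : ∀ p, w p ∈ L := fun p => ⟨p.2.1, by simpa [w] using hdv1 p.1.2.1⟩
  let L' : Set (Y × X) := T ×ˢ Metric.closedBall 0 1
  have hL' : IsCompact L' := hT.prod (isCompact_closedBall 0 1)
  have hwL' : ∀ p, w' p ∈ L' := fun p => ⟨p.2.2.2.2, by simpa [w'] using hdv1 p.1.2.1⟩
  -- the first directional derivative of the phase and the lifted amplitude
  let F : (Z × X) × X → ℝ := fun q => fderiv ℝ φ (q.1.1, q.2) (0, q.1.2)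
  have hF : ContDiff ℝ ∞ F :=
    ((hφ.fderiv_right (m := ∞) (by simp)).comp
      ((contDiff_fst.comp contDiff_fst).prodMk contDiff_snd)).clm_apply
      (contDiff_const.prodMk (contDiff_snd.comp contDiff_fst))
  let A : (Y × X) × X → ℝ := fun q => α (q.1.1, q.2)
  have hA : ContDiff ℝ ∞ A := hα.comp ((contDiff_fst.comp contDiff_fst).prodMk contDiff_snd)
  let b : P → X → ℝ := fun p x => (F (w p, x + hh p) - F (w p, x)) / ‖hh p‖
  have hub : ∀ k, UB (fun p => V (w p)) S k b := fun k =>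
    UB.differenceQuotient V hL hBcp (convex_closedBall u r) (fun p => p.2.2.1) hwL hSB hF
  let a : P → X → ℝ := fun p x => A (w' p, x + hh p) * A (w' p, x + 0)
  have ha1 : ∀ p, ContDiff ℝ ∞ (fun x => A (w' p, x + hh p)) := fun p => contDiff_slice hA _ _
  have ha2 : ∀ p, ContDiff ℝ ∞ (fun x => A (w' p, x + 0)) := fun p => contDiff_slice hA _ _
  have hua : ∀ k, UB (fun p => V (w p)) S k a := fun k =>
    UB.mul hSo (fun p => (ha1 p).contDiffOn) (fun p => (ha2 p).contDiffOn)
      (UB.of_joint V' (hL'.prod hBcp) (fun p x hx => ⟨hwL' p, (hSB p x hx).2⟩) hA)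
      (UB.of_joint V' (hL'.prod hBcp)
        (fun p x hx => ⟨hwL' p, by simpa using (hSB p x hx).1⟩) hA)
  have htS : ∀ p, tsupport (a p) ⊆ S p := by
    intro p x hx
    refine ⟨?_, ?_⟩
    · have : x ∈ tsupport (fun x => A (w' p, x + 0)) := tsupport_mul_subset_right hx
      simp only [add_zero] at this
      exact hsupp _ p.2.2.2.2 this
    · have : x ∈ tsupport (fun x => A (w' p, x + hh p)) := tsupport_mul_subset_left hx
      have h2 := tsupport_comp_subset_preimage (fun x => A (w' p, x))
        (f := fun x => x + hh p) (by fun_prop) this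
      exact hsupp _ p.2.2.2.2 h2
  let Φ : P → X → ℝ := fun p x => lam p * (φ (p.1.1, x + hh p) - φ (p.1.1, x))
  have hs0 : ∀ z, ContDiff ℝ ∞ (fun x => φ (z, x)) := fun z => by
    simpa using contDiff_slice hφ z 0
  have hΦ : ∀ p, ContDiff ℝ ∞ (Φ p) := fun p =>
    contDiff_const.mul ((contDiff_slice hφ _ _).sub (hs0 _))
  have hbs : ∀ p, ContDiff ℝ ∞ (b p) := fun p =>
    ((contDiff_slice hF _ _).sub (by simpa using contDiff_slice hF (w p) 0)).div_const _
  have hΦb : ∀ p x, fderiv ℝ (Φ p) x (V (w p)) = (lam p * ‖hh p‖) * b p x := by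
    intro p x
    have d1 := ((contDiff_slice hφ p.1.1 (hh p)).differentiable (by simp)) x
    have d2 := ((hs0 p.1.1).differentiable (by simp)) x
    have hne : ‖hh p‖ ≠ 0 := norm_ne_zero_iff.2 p.2.2.1
    simp only [Φ, b]
    rw [fderiv_const_mul (d1.fun_sub d2), fderiv_fun_sub d1 d2, _root_.smul_apply,
      _root_.sub_apply, fderiv_slice hφ, fderiv_slice' hφ, smul_eq_mul]
    simp only [F, V, w, ContinuousLinearMap.coe_snd']
    field_simp
  have hblow : ∀ p, ∀ x ∈ S p, c ≤ |b p x| := by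
    intro p x hx
    have hpos : 0 < ‖hh p‖ := norm_pos_iff.2 p.2.2.1
    refine le_trans ?_ (le_abs_self _)
    simp only [b]
    rw [le_div_iff₀ hpos]
    let γ : ℝ → ℝ := fun s => F (w p, x + s • hh p)
    have hγd : ∀ s, HasDerivAt γ
        (fderiv ℝ (fderiv ℝ φ) (p.1.1, x + s • hh p) (0, hh p) (0, dv (hh p))) s := by
      intro s
      have h1 : HasDerivAt (fun s : ℝ => (p.1.1, x + s • hh p)) ((0 : Z), hh p) s := by
        have h2 : HasDerivAt (fun s : ℝ => x + s • hh p) (hh p) s := by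
          simpa using ((hasDerivAt_id s).smul_const (hh p)).const_add x
        exact (hasDerivAt_const s p.1.1).prodMk h2
      have h3 := (((hφ.fderiv_right (m := ∞) (by simp)).differentiable (by simp))
        (p.1.1, x + s • hh p)).hasFDerivAt.comp_hasDerivAt s h1
      exact h3.clm_apply (hasDerivAt_const s ((0 : Z), dv (hh p))) |>.congr_deriv (by simp)
    have hmv := Convex.mul_sub_le_image_sub_of_le_deriv (D := Icc (0 : ℝ) 1) (convex_Icc 0 1)
      (f := γ) (C := c * ‖hh p‖) (fun s _ => (hγd s).continuousAt.continuousWithinAt)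
      (fun s _ => (hγd s).differentiableAt.differentiableWithinAt) ?_ 0 (by simp) 1 (by simp)
      (by norm_num)
    · simpa [γ] using hmv
    · intro s hs
      rw [interior_Icc] at hs
      rw [(hγd s).deriv]
      refine hdv (hh p) _ p.2.1 _ ?_
      have hcv := (convex_ball u r) hx.1 hx.2 (a := 1 - s) (b := s) (by linarith [hs.2])
        hs.1.le (by ring)
      convert hcv using 1
      simp only [smul_add, sub_smul, one_smul]
      abel
  have hκ : ∀ p, 0 < lam p * ‖hh p‖ := fun p => mul_pos p.2.2.2.1 (norm_pos_iff.2 p.2.2.1)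
  have hNS := fun N => nonstationary_phase (μ := μ) hSo hBcp hκ hΦ hbs hΦb hc hblow hub N a
    (fun p => (ha1 p).mul (ha2 p)) htS
    (fun p => (htS p).trans fun x hx => (hSB p x hx).1) hua
  obtain ⟨C0, hC0⟩ := hNS 0
  set d := finrank ℝ X with hd
  obtain ⟨C1, hC1⟩ := hNS (d + 1)
  let C2 : ℝ := max (max C0 C1) 0 * 2 ^ (d + 1)
  have hC2 : ∀ p, ‖∫ x, a p x • Complex.exp ((Φ p x : ℂ) * Complex.I) ∂μ‖
      ≤ C2 * (1 + lam p * ‖hh p‖) ^ (-((d : ℝ) + 1)) := by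
    intro p
    have hk := hκ p
    set k := lam p * ‖hh p‖ with hkdef
    have hCm : 0 ≤ max (max C0 C1) 0 := le_max_right _ _
    have hrw : (1 + k) ^ (-((d : ℝ) + 1)) = ((1 + k) ^ (d + 1))⁻¹ := by
      rw [Real.rpow_neg (by positivity)]
      congr 1
      exact_mod_cast Real.rpow_natCast (1 + k) (d + 1)
    rw [hrw]
    have hgoal : ∀ y : ℝ, y ≤ max (max C0 C1) 0 * (2 / (1 + k)) ^ (d + 1) →
        y ≤ C2 * ((1 + k) ^ (d + 1))⁻¹ := by
      intro y hy
      refine hy.trans (le_of_eq ?_)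
      simp only [C2, div_pow]
      ring
    apply hgoal
    rcases le_total k 1 with h1 | h1
    · refine (hC0 p).trans ?_
      rw [pow_zero, mul_one]
      calc C0 ≤ max (max C0 C1) 0 * 1 := by
            rw [mul_one]; exact (le_max_left _ _).trans (le_max_left _ _)
        _ ≤ _ := by
            apply mul_le_mul_of_nonneg_left _ hCm
            apply one_le_pow₀
            rw [le_div_iff₀ (by positivity)]; linarith
    · refine (hC1 p).trans ?_
      apply mul_le_mul ((le_max_right _ _).trans (le_max_left _ _)) _ (by positivity) hCm
      apply pow_le_pow_left₀ (by positivity)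
      rw [inv_eq_one_div, div_le_div_iff₀ hk (by positivity)]
      linarith
  have hjb : Integrable (fun x : X => (1 + ‖x‖) ^ (-((d : ℝ) + 1))) μ :=
    integrable_one_add_norm (by rw [hd]; linarith)
  let J : ℝ := ∫ x : X, (1 + ‖x‖) ^ (-((d : ℝ) + 1)) ∂μ
  have hJ : 0 ≤ J := integral_nonneg fun x => by positivity
  have hC20 : 0 ≤ C2 := by positivity
  refine ⟨Real.sqrt (C2 * J), fun z hz t ht l hl => ?_⟩
  set f : X → ℂ := fun x => α (t, x) • Complex.exp (((l * φ (z, x) : ℝ) : ℂ) * Complex.I) with hf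
  have hαt : ContDiff ℝ ∞ (fun x => α (t, x)) := by simpa using contDiff_slice hα t 0
  have hfcont : Continuous f := by
    have h1 := hαt.continuous
    have h2 := (hs0 z).continuous
    exact h1.smul (Complex.continuous_exp.comp
      ((Complex.continuous_ofReal.comp (continuous_const.mul h2)).mul continuous_const))
  have hfcs : HasCompactSupport f := by
    have : HasCompactSupport (fun x => α (t, x)) :=
      hBcp.of_isClosed_subset (isClosed_tsupport _)
        ((hsupp t ht).trans Metric.ball_subset_closedBall)
    exact this.smul_right
  have hle : ‖∫ x, f x ∂μ‖ ^ 2 ≤ ∫ h, C2 * (1 + ‖l • h‖) ^ (-((d : ℝ) + 1)) ∂μ := by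
    refine (norm_integral_sq_le_autocorrelation hfcont hfcs).trans ?_
    refine integral_mono_of_nonneg (ae_of_all _ fun h => norm_nonneg _) ?_ ?_
    · exact (hjb.comp_smul hl.ne').const_mul C2
    · have hne : ∀ᵐ h ∂μ, h ≠ 0 := Measure.ae_ne μ 0
      filter_upwards [hne] with h hh0
      have := hC2 ⟨(z, h, l, t), hz, hh0, hl, ht⟩
      rw [norm_smul, Real.norm_eq_abs, abs_of_pos hl]
      refine le_trans (le_of_eq ?_) this
      congr 2
      ext x
      simp only [hf, a, A, w', Φ, hh, lam, add_zero, Complex.real_smul, map_mul, Complex.conj_ofReal,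
        ← Complex.exp_conj, Complex.conj_I]
      push_cast
      have : Complex.exp (l * (φ (z, x + h) - φ (z, x)) * Complex.I)
          = Complex.exp (l * φ (z, x + h) * Complex.I) * Complex.exp (l * φ (z, x) * -Complex.I) := by
        rw [← Complex.exp_add]; congr 1; ring
      rw [this]
      ring
  have hsc : ∫ h, C2 * (1 + ‖l • h‖) ^ (-((d : ℝ) + 1)) ∂μ = C2 * J * l ^ (-(d : ℝ)) := by
    rw [integral_const_mul,
      Measure.integral_comp_smul μ (fun x : X => (1 + ‖x‖) ^ (-((d : ℝ) + 1))) l, ← hd,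
      abs_of_pos (by positivity), smul_eq_mul, Real.rpow_neg hl.le, Real.rpow_natCast]
    simp only [J]
    ring
  rw [hsc] at hle
  refine abs_le_of_sq_le_sq' (?_ : _ ^ 2 ≤ _ ^ 2) (by positivity) |>.2
  rw [mul_pow, Real.sq_sqrt (by positivity), ← Real.rpow_natCast (l ^ _) 2, ← Real.rpow_mul hl.le]
  refine hle.trans (le_of_eq ?_)
  congr 2
  push_cast; ring

open Module in
theorem oscillatory_of_gradient {φ : Z × X → ℝ} {α : Y × X → ℝ} (hφ : ContDiff ℝ ∞ φ)
    (hα : ContDiff ℝ ∞ α) {K : Set Z} (hK : IsCompact K) {T : Set Y} (hT : IsCompact T)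
    {u : X} {r : ℝ}
    (hsupp : ∀ t ∈ T, tsupport (fun x => α (t, x)) ⊆ Metric.ball u r)
    {c : ℝ} (hc : 0 < c) {v : X}
    (hnd : ∀ z ∈ K, ∀ x ∈ Metric.ball u r, c ≤ |fderiv ℝ φ (z, x) (0, v)|) :
    ∃ C : ℝ, ∀ z ∈ K, ∀ t ∈ T, ∀ l : ℝ, 0 < l →
      ‖∫ x, α (t, x) • Complex.exp (((l * φ (z, x) : ℝ) : ℂ) * Complex.I) ∂μ‖
        ≤ C * l ^ (-(finrank ℝ X : ℝ) / 2) := by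
  let P := {q : Z × Y × ℝ // q.1 ∈ K ∧ q.2.1 ∈ T ∧ 0 < q.2.2}
  let B : Set X := Metric.closedBall u r
  have hBcp : IsCompact B := isCompact_closedBall u r
  let S : P → Set X := fun _ => Metric.ball u r
  have hSo : ∀ p, IsOpen (S p) := fun p => Metric.isOpen_ball
  have hSB : ∀ p, ∀ x ∈ S p, x ∈ B := fun p x hx => Metric.ball_subset_closedBall hx
  let F : (Z × X) × X → ℝ := fun q => fderiv ℝ φ (q.1.1, q.2) (0, q.1.2)
  have hF : ContDiff ℝ ∞ F :=
    ((hφ.fderiv_right (m := ∞) (by simp)).comp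
      ((contDiff_fst.comp contDiff_fst).prodMk contDiff_snd)).clm_apply
      (contDiff_const.prodMk (contDiff_snd.comp contDiff_fst))
  let A : (Y × X) × X → ℝ := fun q => α (q.1.1, q.2)
  have hA : ContDiff ℝ ∞ A := hα.comp ((contDiff_fst.comp contDiff_fst).prodMk contDiff_snd)
  let w : P → Z × X := fun p => (p.1.1, v)
  let w' : P → Y × X := fun p => (p.1.2.1, v)
  have hub : ∀ k, UB (fun _ : P => v) S k (fun p x => F (w p, x + 0)) := fun k =>
    UB.of_joint (ContinuousLinearMap.snd ℝ Z X) (w := w) (τ := fun _ => 0)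
      ((hK.prod isCompact_singleton).prod hBcp)
      (fun p x hx => ⟨⟨p.2.1, rfl⟩, by simpa using hSB p x hx⟩) hF
  have hua : ∀ k, UB (fun _ : P => v) S k (fun p x => A (w' p, x + 0)) := fun k =>
    UB.of_joint (ContinuousLinearMap.snd ℝ Y X) (w := w') (τ := fun _ => 0)
      ((hT.prod isCompact_singleton).prod hBcp)
      (fun p x hx => ⟨⟨p.2.2.1, rfl⟩, by simpa using hSB p x hx⟩) hA
  have hs0 : ∀ z, ContDiff ℝ ∞ (fun x => φ (z, x)) := fun z => by
    simpa using contDiff_slice hφ z 0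
  have htS : ∀ p, tsupport (fun x => A (w' p, x + 0)) ⊆ S p := fun p => by
    simpa only [add_zero] using hsupp _ p.2.2.1
  have hNS := fun N => nonstationary_phase (μ := μ) (κ := fun p : P => p.1.2.2)
    (φ := fun p x => p.1.2.2 * φ (p.1.1, x)) hSo hBcp (fun p => p.2.2.2)
    (fun p => contDiff_const.mul (hs0 _)) (fun p => contDiff_slice hF (w p) 0)
    (fun p x => by
      rw [fderiv_const_mul (((hs0 p.1.1).differentiable (by simp)) x), _root_.smul_apply,
        fderiv_slice' hφ, smul_eq_mul]
      simp [F, w]) hc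
    (fun p x hx => by simpa [F, w] using hnd _ p.2.1 x hx) hub N _
    (fun p => contDiff_slice hA (w' p) 0) htS (fun p => (htS p).trans (hSB p)) hua
  obtain ⟨C0, hC0⟩ := hNS 0
  obtain ⟨C1, hC1⟩ := hNS (finrank ℝ X)
  refine ⟨max (max C0 C1) 0, fun z hz t ht l hl => ?_⟩
  have hCm : 0 ≤ max (max C0 C1) 0 := le_max_right _ _
  have h0 := hC0 ⟨(z, t, l), hz, ht, hl⟩
  have h1 := hC1 ⟨(z, t, l), hz, ht, hl⟩
  simp only [A, w', add_zero, pow_zero, mul_one] at h0 h1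
  have hd : (0 : ℝ) ≤ finrank ℝ X := Nat.cast_nonneg _
  rcases le_total l 1 with hl1 | hl1
  · refine h0.trans ?_
    calc C0 ≤ max (max C0 C1) 0 * 1 := by
          rw [mul_one]; exact (le_max_left _ _).trans (le_max_left _ _)
      _ ≤ _ := mul_le_mul_of_nonneg_left
        (Real.one_le_rpow_of_pos_of_le_one_of_nonpos hl hl1 (by linarith)) hCm
  · refine h1.trans (mul_le_mul ((le_max_right _ _).trans (le_max_left _ _)) ?_
      (by positivity) hCm)
    rw [inv_pow, ← Real.rpow_natCast, ← Real.rpow_neg hl.le]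
    exact Real.rpow_le_rpow_of_exponent_le hl1 (by linarith)

theorem eventually_norm_sub_lt {Q E : Type*} [TopologicalSpace Q] [SeminormedAddCommGroup E]
    {f : Q → E} (hf : Continuous f) (q₀ : Q) {c : ℝ} (hc : 0 < c) :
    ∀ᶠ q in 𝓝 q₀, ‖f q - f q₀‖ < c := by
  have := Metric.tendsto_nhds.1 (hf.tendsto q₀) c hc
  simpa only [dist_eq_norm] using this

open Module in
/-- Uniform bound for oscillatory integrals localised near a point that is either not
critical or is a non-degenerate critical point of the phase. -/
theorem oscillatory_local [FiniteDimensional ℝ Z] [Nontrivial X] {φ : Z × X → ℝ}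
    (hφ : ContDiff ℝ ∞ φ)
    {z₀ : Z} {u₀ : X}
    (hcrit : (∀ v, fderiv ℝ φ (z₀, u₀) (0, v) = 0) →
      ∀ h, (∀ k, fderiv ℝ (fderiv ℝ φ) (z₀, u₀) (0, h) (0, k) = 0) → h = 0) :
    ∃ r : ℝ, 0 < r ∧ ∀ (T : Set Y) (α : Y × X → ℝ), IsCompact T → ContDiff ℝ ∞ α →
      (∀ t ∈ T, tsupport (fun x => α (t, x)) ⊆ Metric.ball u₀ r) →
      ∃ C : ℝ, ∀ z ∈ Metric.closedBall z₀ r, ∀ t ∈ T, ∀ l : ℝ, 0 < l →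
        ‖∫ x, α (t, x) • Complex.exp (((l * φ (z, x) : ℝ) : ℂ) * Complex.I) ∂μ‖
          ≤ C * l ^ (-(finrank ℝ X : ℝ) / 2) := by
  by_cases hgrad : ∀ v, fderiv ℝ φ (z₀, u₀) (0, v) = 0
  · have hH := hcrit hgrad
    let ι : X →L[ℝ] Z × X := ContinuousLinearMap.inr ℝ Z X
    have hι : ∀ x, ‖ι x‖ ≤ ‖x‖ := fun x => by simp [ι, Prod.norm_def]
    let H : Z × X → X →L[ℝ] X →L[ℝ] ℝ := fun q =>
      (((ContinuousLinearMap.compL ℝ X (Z × X) ℝ).flip ι).comp (fderiv ℝ (fderiv ℝ φ) q)).comp ι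
    have hHapp : ∀ q h k, H q h k = fderiv ℝ (fderiv ℝ φ) q (0, h) (0, k) := fun q h k => rfl
    have hHc : Continuous H := by
      have : Continuous (fderiv ℝ (fderiv ℝ φ)) :=
        ((hφ.fderiv_right (m := ∞) (by simp)).continuous_fderiv (by simp))
      fun_prop
    have hker : LinearMap.ker (H (z₀, u₀) : X →ₗ[ℝ] X →L[ℝ] ℝ) = ⊥ := by
      rw [LinearMap.ker_eq_bot']
      intro h hh
      refine hH h fun k => ?_
      rw [← hHapp]
      have : H (z₀, u₀) h = 0 := hh
      rw [this]; rfl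
    obtain ⟨κ, hκ, hanti⟩ := LinearMap.exists_antilipschitzWith _ hker
    have hκ' : (0 : ℝ) < κ := hκ
    have hlow : ∀ h, ‖h‖ ≤ κ * ‖H (z₀, u₀) h‖ := fun h => by
      have := hanti.le_mul_norm_sub (x := h) (y := 0)
      simpa using this
    set c : ℝ := (4 * (κ : ℝ))⁻¹ with hcdef
    have hc : 0 < c := by positivity
    have hnear : ∀ᶠ q in 𝓝 (z₀, u₀), ‖H q - H (z₀, u₀)‖ < c :=
      @eventually_norm_sub_lt (Z × X) (X →L[ℝ] X →L[ℝ] ℝ) _ _ H hHc (z₀, u₀) c hc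
    obtain ⟨r, hr, hball⟩ := Metric.eventually_nhds_iff.1 hnear
    refine ⟨r / 2, by positivity, fun T α hT hα hsupp => ?_⟩
    refine oscillatory_of_hessian hφ hα (isCompact_closedBall z₀ (r / 2)) hT hsupp hc ?_
    intro h
    by_cases hh : h = 0
    · exact ⟨0, by simp, fun z _ x _ => by
        rw [← hHapp, hh, map_zero]; simp⟩
    have hh' : 0 < ‖h‖ := norm_pos_iff.2 hh
    have hlt : (2 * κ : ℝ)⁻¹ * ‖h‖ < ‖H (z₀, u₀) h‖ := by
      have h1 := hlow h
      rw [inv_mul_lt_iff₀ (by positivity)]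
      nlinarith
    obtain ⟨v, hv1, hv⟩ : ∃ v : X, ‖v‖ ≤ 1 ∧ (2 * κ : ℝ)⁻¹ * ‖h‖ ≤ H (z₀, u₀) h v := by
      obtain ⟨v, hv1, hv⟩ := ContinuousLinearMap.exists_lt_apply_of_lt_opNorm _ hlt
      rcases le_total 0 (H (z₀, u₀) h v) with h0 | h0
      · exact ⟨v, hv1.le, by rw [Real.norm_eq_abs, abs_of_nonneg h0] at hv; exact hv.le⟩
      · refine ⟨-v, by simpa using hv1.le, ?_⟩
        rw [Real.norm_eq_abs, abs_of_nonpos h0] at hv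
        simpa using hv.le
    refine ⟨v, hv1, fun z hz x hx => ?_⟩
    rw [← hHapp]
    have hd : dist (z, x) (z₀, u₀) < r := by
      rw [Prod.dist_eq]
      refine max_lt (lt_of_le_of_lt (Metric.mem_closedBall.1 hz) (by linarith))
        (lt_trans (Metric.mem_ball.1 hx) (by linarith))
    have h2 : ‖H (z, x) - H (z₀, u₀)‖ < c := hball hd
    have h3 : |(H (z, x) - H (z₀, u₀)) h v| ≤ c * ‖h‖ := by
      rw [← Real.norm_eq_abs]
      refine (ContinuousLinearMap.le_opNorm₂ _ _ _).trans ?_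
      calc _ ≤ c * ‖h‖ * 1 := by gcongr
        _ = _ := mul_one _
    have h4 := (abs_le.1 h3).1
    simp only [_root_.sub_apply] at h4
    have h5 : (2 * κ : ℝ)⁻¹ = 2 * c := by rw [hcdef]; field_simp; norm_num
    rw [h5] at hv
    linarith
  · push Not at hgrad
    obtain ⟨v, hv⟩ := hgrad
    have hcont : Continuous fun q => |fderiv ℝ φ q (0, v)| :=
      ((hφ.continuous_fderiv (by simp)).clm_apply continuous_const).abs
    set c : ℝ := |fderiv ℝ φ (z₀, u₀) (0, v)| / 2 with hcdef
    have hpos := abs_pos.2 hv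
    have hc : 0 < c := by positivity
    have hnear : ∀ᶠ q in 𝓝 (z₀, u₀), c < |fderiv ℝ φ q (0, v)| :=
      hcont.continuousAt.eventually (lt_mem_nhds (by rw [hcdef]; linarith))
    obtain ⟨r, hr, hball⟩ := Metric.eventually_nhds_iff.1 hnear
    refine ⟨r / 2, by positivity, fun T α hT hα hsupp => ?_⟩
    refine oscillatory_of_gradient hφ hα (isCompact_closedBall z₀ (r / 2)) hT hsupp hc
      (v := v) ?_
    intro z hz x hx
    refine (hball ?_).le
    rw [Prod.dist_eq]
    exact max_lt (lt_of_le_of_lt (Metric.mem_closedBall.1 hz) (by linarith))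
        (lt_trans (Metric.mem_ball.1 hx) (by linarith))

end Oscillatory

/-- A gauge function whose unit body has smooth boundary with non-degenerate second
fundamental form. -/
structure IsGauge {E : Type*} [NormedAddCommGroup E] [NormedSpace ℝ E] (g : E → ℝ) : Prop where
  cont : Continuous g
  pos : ∀ x, x ≠ 0 → 0 < g x
  hom : ∀ t : ℝ, 0 < t → ∀ x, g (t • x) = t * g x
  smooth : ContDiffOn ℝ ∞ g {0}ᶜ
  nondeg : ∀ x, x ≠ 0 → ∀ v,
    (∀ w, fderiv ℝ (fun y => fderiv ℝ g y) x v w = 0) ↔ ∃ c : ℝ, v = c • x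

section Projective

variable {E X : Type*} [NormedAddCommGroup E] [NormedSpace ℝ E]
  [NormedAddCommGroup X] [NormedSpace ℝ X] {g : E → ℝ}

theorem IsGauge.contDiffAt (hg : IsGauge g) {x : E} (hx : x ≠ 0) : ContDiffAt ℝ ∞ g x :=
  hg.smooth.contDiffAt (isOpen_compl_singleton.mem_nhds hx)

/-- The affine chart `u ↦ A (1, u)` of a hyperplane missing the origin. -/
theorem chart_ne_zero (A : (ℝ × X) ≃L[ℝ] E) (u : X) : A (1, u) ≠ 0 := by
  intro h
  have := A.map_eq_zero_iff.1 h
  simp at this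

theorem contDiff_chart (A : (ℝ × X) ≃L[ℝ] E) : ContDiff ℝ ∞ (fun u : X => A (1, u)) :=
  A.contDiff.comp (contDiff_const.prodMk contDiff_id)

theorem IsGauge.contDiff_comp_chart (hg : IsGauge g) (A : (ℝ × X) ≃L[ℝ] E) :
    ContDiff ℝ ∞ (fun u : X => g (A (1, u))) :=
  contDiff_iff_contDiffAt.2 fun u =>
    (hg.contDiffAt (chart_ne_zero A u)).comp u (contDiff_chart A).contDiffAt

theorem IsGauge.pos_chart (hg : IsGauge g) (A : (ℝ × X) ≃L[ℝ] E) (u : X) : 0 < g (A (1, u)) :=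
  hg.pos _ (chart_ne_zero A u)

theorem hasFDerivAt_chart (A : (ℝ × X) ≃L[ℝ] E) (u : X) :
    HasFDerivAt (fun u : X => A (1, u)) ((A : (ℝ × X) →L[ℝ] E).comp
      (ContinuousLinearMap.inr ℝ ℝ X)) u :=
  (A : (ℝ × X) →L[ℝ] E).hasFDerivAt.comp u
    ((hasFDerivAt_const (𝕜 := ℝ) (1 : ℝ) u).prodMk (hasFDerivAt_id u))

theorem IsGauge.fderiv_comp_chart (hg : IsGauge g) (A : (ℝ × X) ≃L[ℝ] E) (u k : X) :
    fderiv ℝ (fun u : X => g (A (1, u))) u k = fderiv ℝ g (A (1, u)) (A (0, k)) := by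
  have h := ((hg.contDiffAt (chart_ne_zero A u)).differentiableAt (by simp)).hasFDerivAt.comp u
    (hasFDerivAt_chart A u)
  have h2 : fderiv ℝ (fun u : X => g (A (1, u))) u = _ := h.fderiv
  rw [h2]; simp

theorem IsGauge.fderiv_fderiv_comp_chart (hg : IsGauge g) (A : (ℝ × X) ≃L[ℝ] E) (u h k : X) :
    fderiv ℝ (fun v => fderiv ℝ (fun u : X => g (A (1, u))) v k) u h
      = fderiv ℝ (fun y => fderiv ℝ g y) (A (1, u)) (A (0, h)) (A (0, k)) := by
  have e : (fun v => fderiv ℝ (fun u : X => g (A (1, u))) v k)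
      = fun v => fderiv ℝ g (A (1, v)) (A (0, k)) := by
    ext v; exact hg.fderiv_comp_chart A v k
  have hd : DifferentiableAt ℝ (fun y => fderiv ℝ g y) (A (1, u)) :=
    ((hg.contDiffAt (chart_ne_zero A u)).fderiv_right (m := 1) (by norm_cast)).differentiableAt
      (by simp)
  have h1 := (hd.hasFDerivAt.comp u (hasFDerivAt_chart A u)).clm_apply
    (hasFDerivAt_const (𝕜 := ℝ) (A (0, k)) u)
  have h2 : fderiv ℝ (fun v => fderiv ℝ g (A (1, v)) (A (0, k))) u = _ := h1.fderiv
  rw [e, h2]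
  simp

theorem IsGauge.hessian_chart_nondegenerate (hg : IsGauge g) (A : (ℝ × X) ≃L[ℝ] E) (u h : X)
    (hh : ∀ k, fderiv ℝ (fun v => fderiv ℝ (fun u : X => g (A (1, u))) v k) u h = 0) : h = 0 := by
  have hx := chart_ne_zero A u
  have hsymm : fderiv ℝ (fun y => fderiv ℝ g y) (A (1, u)) (A (0, h)) (A (1, u)) = 0 := by
    have := (hg.contDiffAt hx).isSymmSndFDerivAt (by simp; norm_cast)
    have h2 := this (A (0, h)) (A (1, u))
    rw [h2]
    exact ((hg.nondeg _ hx (A (1, u))).2 ⟨1, (one_smul _ _).symm⟩) _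
  have hall : ∀ w, fderiv ℝ (fun y => fderiv ℝ g y) (A (1, u)) (A (0, h)) w = 0 := by
    intro w
    obtain ⟨⟨s, v⟩, rfl⟩ := A.surjective w
    have : ((s, v) : ℝ × X) = s • (1, u) + (0, v - s • u) := by ext <;> simp
    rw [this, map_add, map_add, map_smul, map_smul, hsymm, ← hg.fderiv_fderiv_comp_chart A, hh]
    simp
  obtain ⟨c, hc⟩ := (hg.nondeg _ hx _).1 hall
  rw [← map_smul] at hc
  have := A.injective hc
  simp only [Prod.smul_mk, Prod.mk.injEq, smul_eq_mul, mul_one] at this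
  rw [this.2, ← this.1, zero_smul]

/-- The projective phase of the functional `θ` in the chart `A`. -/
noncomputable def phase (g : E → ℝ) (A : (ℝ × X) ≃L[ℝ] E) (q : (E →L[ℝ] ℝ) × X) : ℝ :=
  q.1 (A (1, q.2)) / g (A (1, q.2))

theorem IsGauge.contDiff_phase (hg : IsGauge g) (A : (ℝ × X) ≃L[ℝ] E) :
    ContDiff ℝ ∞ (phase g A) :=
  (contDiff_fst.clm_apply ((contDiff_chart A).comp contDiff_snd)).div
    ((hg.contDiff_comp_chart A).comp contDiff_snd) fun q => (hg.pos_chart A q.2).ne'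

theorem IsGauge.phase_nondegenerate (hg : IsGauge g) (A : (ℝ × X) ≃L[ℝ] E)
    {θ : E →L[ℝ] ℝ} (hθ : θ ≠ 0) (u : X)
    (hcrit : ∀ v, fderiv ℝ (phase g A) (θ, u) (0, v) = 0) (h : X)
    (hh : ∀ k, fderiv ℝ (fderiv ℝ (phase g A)) (θ, u) (0, h) (0, k) = 0) : h = 0 := by
  have hφ := hg.contDiff_phase A
  set p : X → ℝ := fun v => phase g A (θ, v) with hp
  set G : X → ℝ := fun v => g (A (1, v)) with hG
  have hpS : ContDiff ℝ ∞ p := hφ.comp (contDiff_const.prodMk contDiff_id)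
  have hGS : ContDiff ℝ ∞ G := hg.contDiff_comp_chart A
  have hG0 : G u ≠ 0 := (hg.pos_chart A u).ne'
  have hpG : ∀ v, p v * G v = θ (A (1, v)) := fun v => by
    simp only [hp, hG, phase]
    exact div_mul_cancel₀ _ (hg.pos_chart A v).ne'
  have hp1 : ∀ v k, fderiv ℝ p v k = fderiv ℝ (phase g A) (θ, v) (0, k) := fun v k =>
    fderiv_slice' hφ θ v k
  have hp2 : ∀ k, fderiv ℝ (fun v => fderiv ℝ p v k) u h = 0 := by
    intro k
    have hF : ContDiff ℝ ∞ (fun q => fderiv ℝ (phase g A) q (0, k)) :=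
      (hφ.fderiv_right (m := ∞) (by simp)).clm_apply contDiff_const
    have e : (fun v => fderiv ℝ p v k)
        = fun v => (fun q => fderiv ℝ (phase g A) q (0, k)) (θ, v) := by
      ext v; exact hp1 v k
    rw [e, fderiv_slice' hF, fderiv_clm_apply
      ((hφ.fderiv_right (m := ∞) (by simp)).differentiable (by simp) _) (by fun_prop)]
    simp [hh k]
  have hD : ∀ v k, p v * fderiv ℝ G v k + G v * fderiv ℝ p v k = θ (A (0, k)) := by
    intro v k
    have e : (fun v => p v * G v) = fun v => θ (A (1, v)) := funext hpG
    have h1 := fderiv_fun_mul (hpS.differentiable (by simp) v) (hGS.differentiable (by simp) v)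
    have h3 : fderiv ℝ (fun v => θ (A (1, v))) v = _ :=
      (θ.hasFDerivAt.comp v (hasFDerivAt_chart A v)).fderiv
    rw [e, h3] at h1
    have h2 := congrArg (fun L => L k) h1
    simpa using h2.symm
  have hp1u : ∀ k, fderiv ℝ p u k = 0 := fun k => by rw [hp1]; exact hcrit k
  have hpu : p u ≠ 0 := by
    intro h0
    apply hθ
    ext w
    obtain ⟨⟨s, v⟩, rfl⟩ := A.surjective w
    have : ((s, v) : ℝ × X) = s • (1, u) + (0, v - s • u) := by ext <;> simp
    rw [this, map_add, map_add, map_smul, map_smul, ← hpG, ← hD u, h0, hp1u]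
    simp
  refine hg.hessian_chart_nondegenerate A u h fun k => ?_
  have e : (fun v => p v * fderiv ℝ G v k + G v * fderiv ℝ p v k) = fun _ => θ (A (0, k)) :=
    funext fun v => hD v k
  have dp := hpS.differentiable (by simp) u
  have dG := hGS.differentiable (by simp) u
  have dp' : DifferentiableAt ℝ (fun v => fderiv ℝ p v k) u :=
    (((hpS.fderiv_right (m := ∞) (by simp)).clm_apply contDiff_const).differentiable (by simp)) u
  have dG' : DifferentiableAt ℝ (fun v => fderiv ℝ G v k) u :=
    (((hGS.fderiv_right (m := ∞) (by simp)).clm_apply contDiff_const).differentiable (by simp)) u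
  have h1 := fderiv_fun_add (dp.fun_mul dG') (dG.fun_mul dp')
  rw [e, fderiv_fun_mul dp dG', fderiv_fun_mul dG dp'] at h1
  have h2 := congrArg (fun L => L h) h1
  simp [hp1u, hp2] at h2
  exact h2.resolve_left hpu

end Projective

section ProjectiveCoordinates

variable {E X : Type*} [NormedAddCommGroup E] [NormedSpace ℝ E] [FiniteDimensional ℝ E]
  [MeasurableSpace E] [BorelSpace E] (μ : Measure E) [μ.IsAddHaarMeasure]
  [NormedAddCommGroup X] [NormedSpace ℝ X] [FiniteDimensional ℝ X]
  [MeasurableSpace X] [BorelSpace X] (ν : Measure X) [ν.IsAddHaarMeasure] {g : E → ℝ}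

theorem exists_integral_eq_smul_integral_prod (A : (ℝ × X) ≃L[ℝ] E) :
    ∃ c : ℝ, 0 ≤ c ∧ ∀ F : E → ℂ,
      ∫ x, F x ∂μ = c • ∫ z, F (A z) ∂((volume : Measure ℝ).prod ν) := by
  have : ((Measure.map A ((volume : Measure ℝ).prod ν))).IsAddHaarMeasure :=
    A.isAddHaarMeasure_map _
  refine ⟨(μ.addHaarScalarFactor (Measure.map A ((volume : Measure ℝ).prod ν)) : ℝ),
    NNReal.coe_nonneg _, fun F => ?_⟩
  conv_lhs => rw [Measure.isAddLeftInvariant_eq_smul μ (Measure.map A ((volume : Measure ℝ).prod ν))]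
  have h := A.toHomeomorph.measurableEmbedding.integral_map
    (μ := (volume : Measure ℝ).prod ν) F
  rw [integral_smul_nnreal_measure]
  exact congrArg (fun z => μ.addHaarScalarFactor (Measure.map A ((volume : Measure ℝ).prod ν)) • z) h

theorem IsGauge.integral_projective (hg : IsGauge g) (A : (ℝ × X) ≃L[ℝ] E) :
    ∃ c : ℝ, 0 ≤ c ∧ ∀ F : E → ℂ, Continuous F → HasCompactSupport F →
      tsupport F ⊆ {x | 0 < (A.symm x).1} →
      Integrable (fun z : ℝ × X => (|z.1| ^ finrank ℝ X * (g (A (1, z.2)))⁻¹ ^ (finrank ℝ X + 1)) •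
          F ((z.1 / g (A (1, z.2))) • A (1, z.2))) ((volume : Measure ℝ).prod ν) ∧
      ∫ x, F x ∂μ = c • ∫ t : ℝ, ∫ u,
        (|t| ^ finrank ℝ X * (g (A (1, u)))⁻¹ ^ (finrank ℝ X + 1)) •
          F ((t / g (A (1, u))) • A (1, u)) ∂ν := by
  obtain ⟨c, hc, hcF⟩ := exists_integral_eq_smul_integral_prod μ ν A
  refine ⟨c, hc, fun F hF hFc hFs => ?_⟩
  set D := finrank ℝ X with hD
  set G : X → ℝ := fun u => g (A (1, u)) with hG
  have hGpos : ∀ u, 0 < G u := hg.pos_chart A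
  have hGc : Continuous G := (hg.contDiff_comp_chart A).continuous
  have hAc : Continuous fun u : X => A (1, u) := (contDiff_chart A).continuous
  have hK : IsCompact (tsupport F) := hFc
  have hF0 : ∀ x, ¬ 0 < (A.symm x).1 → F x = 0 := fun x hx => by
    by_contra h
    exact hx (hFs (subset_tsupport F h))
  have hsm : ∀ (s : ℝ) (u : X), s • A (1, u) = A (s, s • u) := fun s u => by
    rw [← map_smul]; simp
  have hρ : ContinuousOn (fun x : E => ((A.symm x).1)⁻¹ • (A.symm x).2) (tsupport F) := by
    refine ContinuousOn.smul (ContinuousOn.inv₀ (by fun_prop) fun x hx => (hFs hx).ne')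
      (by fun_prop)
  -- the two integrands
  set F1 : ℝ × X → ℂ := fun z => (|z.1| ^ D) • F (z.1 • A (1, z.2)) with hF1
  set F2 : ℝ × X → ℂ := fun z => (|z.1| ^ D * (G z.2)⁻¹ ^ (D + 1)) •
    F ((z.1 / G z.2) • A (1, z.2)) with hF2
  have hF1c : Continuous F1 := by
    have : Continuous fun z : ℝ × X => A (1, z.2) := hAc.comp continuous_snd
    fun_prop
  have hF2c : Continuous F2 := by
    have h1 : Continuous fun z : ℝ × X => A (1, z.2) := hAc.comp continuous_snd
    have h2 : Continuous fun z : ℝ × X => G z.2 := hGc.comp continuous_snd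
    have h3 : Continuous fun z : ℝ × X => (G z.2)⁻¹ := h2.inv₀ fun z => (hGpos _).ne'
    simp only [hF2, div_eq_mul_inv]
    fun_prop
  have hF1s : HasCompactSupport F1 := by
    refine HasCompactSupport.of_support_subset_isCompact
      (hK.image_of_continuousOn (f := fun x : E => ((A.symm x).1, ((A.symm x).1)⁻¹ • (A.symm x).2))
        (ContinuousOn.prodMk (by fun_prop) hρ)) ?_
    rintro ⟨s, u⟩ hz
    have hz' : F (s • A (1, u)) ≠ 0 := fun h => hz (by simp [hF1, h])
    have hmem := subset_tsupport F hz'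
    refine ⟨_, hmem, ?_⟩
    have hs := hFs hmem
    simp only [hsm, mem_ofPred_eq, ContinuousLinearEquiv.symm_apply_apply] at hs ⊢
    rw [inv_smul_smul₀ hs.ne']
  have hF2s : HasCompactSupport F2 := by
    refine HasCompactSupport.of_support_subset_isCompact
      (hK.image_of_continuousOn (f := fun x : E => ((A.symm x).1 *
        G (((A.symm x).1)⁻¹ • (A.symm x).2), ((A.symm x).1)⁻¹ • (A.symm x).2))
        (ContinuousOn.prodMk (ContinuousOn.mul (by fun_prop) (hGc.comp_continuousOn hρ)) hρ)) ?_
    rintro ⟨t, u⟩ hz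
    have hz' : F ((t / G u) • A (1, u)) ≠ 0 := fun h => hz (by simp [hF2, h])
    have hmem := subset_tsupport F hz'
    refine ⟨_, hmem, ?_⟩
    have hs := hFs hmem
    simp only [hsm, mem_ofPred_eq, ContinuousLinearEquiv.symm_apply_apply] at hs ⊢
    rw [inv_smul_smul₀ hs.ne', div_mul_cancel₀ _ (hGpos u).ne']
  have hI1 : Integrable F1 ((volume : Measure ℝ).prod ν) :=
    hF1c.integrable_of_hasCompactSupport hF1s
  have hI2 : Integrable F2 ((volume : Measure ℝ).prod ν) :=
    hF2c.integrable_of_hasCompactSupport hF2s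
  have hI0 : Integrable (fun z => F (A z)) ((volume : Measure ℝ).prod ν) :=
    (hF.comp A.continuous).integrable_of_hasCompactSupport
      (hFc.comp_homeomorph A.toHomeomorph)
  refine ⟨hI2, ?_⟩
  rw [hcF, integral_prod _ hI0]
  congr 1
  have e1 : ∀ s : ℝ, ∫ w, F (A (s, w)) ∂ν = ∫ u, F1 (s, u) ∂ν := by
    intro s
    simp only [hF1, hsm]
    rw [integral_smul]
    rcases eq_or_ne s 0 with rfl | hs
    · have : ∀ w, F (A (0, w)) = 0 := fun w => hF0 _ (by simp)
      simp [this]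
    · have := Measure.integral_comp_smul ν (fun w => F (A (s, w))) s
      rw [this, smul_smul, ← hD, abs_inv, abs_pow, mul_inv_cancel₀, one_smul]
      positivity
  have e2 : ∀ u : X, ∫ s : ℝ, F1 (s, u) = ∫ t : ℝ, F2 (t, u) := by
    intro u
    have hG0 := hGpos u
    have := Measure.integral_comp_mul_left (fun s => F1 (s, u)) (G u)⁻¹
    rw [inv_inv, abs_of_pos hG0] at this
    have h2 : ∫ s : ℝ, F1 (s, u) = (G u)⁻¹ • ∫ t : ℝ, F1 ((G u)⁻¹ * t, u) := by
      rw [this, smul_smul, inv_mul_cancel₀ hG0.ne', one_smul]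
    rw [h2, ← integral_smul]
    refine integral_congr_ae (Eventually.of_forall fun t => ?_)
    simp only [hF1, hF2, smul_smul, abs_mul, abs_inv, abs_of_pos hG0]
    rw [div_eq_inv_mul]
    congr 1
    ring
  calc ∫ s, ∫ w, F (A (s, w)) ∂ν = ∫ s, ∫ u, F1 (s, u) ∂ν := by simp_rw [e1]
    _ = ∫ u, ∫ s, F1 (s, u) ∂volume ∂ν := integral_integral_swap (f := fun s u => F1 (s, u)) hI1
    _ = ∫ u, ∫ t, F2 (t, u) ∂volume ∂ν := by simp_rw [e2]
    _ = ∫ t, ∫ u, F2 (t, u) ∂ν := (integral_integral_swap (f := fun s u => F2 (s, u)) hI2).symm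

theorem IsGauge.local_decay [Nontrivial X] (hg : IsGauge g) (A : (ℝ × X) ≃L[ℝ] E)
    {θ₀ : E →L[ℝ] ℝ} (hθ₀ : θ₀ ≠ 0) :
    ∃ V : Set E, IsOpen V ∧ A (1, 0) ∈ V ∧ ∃ r : ℝ, 0 < r ∧
      ∀ a : E → ℝ, ContDiff ℝ ∞ a → HasCompactSupport a → tsupport a ⊆ V →
      ∃ C : ℝ, 0 ≤ C ∧ ∀ ψ : ℝ → ℝ, Continuous ψ → Function.support ψ ⊆ Icc (1 / 4) 2 →
      ∀ θ ∈ Metric.closedBall θ₀ r, ∀ l : ℝ, 0 < l →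
        ‖∫ x, (ψ (g x) * a x) • Complex.exp (((l * θ x : ℝ) : ℂ) * Complex.I) ∂μ‖
          ≤ C * l ^ (-(finrank ℝ X : ℝ) / 2) * ∫ t, |ψ t| := by
  obtain ⟨c, hc, hcF⟩ := hg.integral_projective μ (addHaar : Measure X) A
  obtain ⟨r, hr, hosc⟩ := oscillatory_local (Y := ℝ) (μ := (addHaar : Measure X))
    (hg.contDiff_phase A) (z₀ := θ₀) (u₀ := (0 : X)) (hg.phase_nondegenerate A hθ₀ 0)
  set D := finrank ℝ X with hD
  refine ⟨{x | 0 < (A.symm x).1 ∧ ‖(A.symm x).2‖ < r * (A.symm x).1}, ?_, by simp [hr], r, hr, ?_⟩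
  · have h1 : Continuous fun x => (A.symm x).1 := by fun_prop
    have h2 : Continuous fun x => ‖(A.symm x).2‖ := by fun_prop
    exact (isOpen_lt continuous_const h1).inter (isOpen_lt h2 (continuous_const.mul h1))
  intro a ha hac hav
  set G : X → ℝ := fun u => g (A (1, u)) with hG
  have hGpos : ∀ u, 0 < G u := hg.pos_chart A
  have hGs : ContDiff ℝ ∞ G := hg.contDiff_comp_chart A
  have hsm : ∀ (s : ℝ) (u : X), s • A (1, u) = A (s, s • u) := fun s u => by
    rw [← map_smul]; simp
  set α : ℝ × X → ℝ := fun z => (G z.2)⁻¹ ^ (D + 1) * a ((z.1 / G z.2) • A (1, z.2)) with hα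
  have hαs : ContDiff ℝ ∞ α := by
    have h1 : ContDiff ℝ ∞ fun z : ℝ × X => (G z.2)⁻¹ :=
      (hGs.comp contDiff_snd).inv fun z => (hGpos _).ne'
    have h2 : ContDiff ℝ ∞ fun z : ℝ × X => z.1 / G z.2 :=
      contDiff_fst.div (hGs.comp contDiff_snd) fun z => (hGpos _).ne'
    have h3 : ContDiff ℝ ∞ fun z : ℝ × X => A (1, z.2) := (contDiff_chart A).comp contDiff_snd
    exact (h1.pow _).mul (ha.comp (h2.smul h3))
  have hsub : ∀ t ∈ Icc (1 / 4 : ℝ) 2, tsupport (fun u => α (t, u)) ⊆ Metric.ball 0 r := by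
    intro t ht u hu
    have hcl : IsClosed {u : X | (t / G u) • A (1, u) ∈ tsupport a} := by
      refine (isClosed_tsupport a).preimage ?_
      have : Continuous fun u : X => t / G u :=
        continuous_const.div hGs.continuous fun u => (hGpos u).ne'
      exact this.smul (contDiff_chart A).continuous
    have hu' : (t / G u) • A (1, u) ∈ tsupport a := by
      refine closure_minimal (fun u hu => ?_) hcl hu
      refine subset_tsupport a ?_
      intro h
      exact hu (by simp [hα, h])
    obtain ⟨h1, h2⟩ := hav hu'
    rw [hsm] at h1 h2
    simp only [ContinuousLinearEquiv.symm_apply_apply, norm_smul, Real.norm_eq_abs] at h1 h2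
    rw [abs_of_pos h1, mul_comm] at h2
    simpa using lt_of_mul_lt_mul_right h2 h1.le
  obtain ⟨C, hC⟩ := hosc (Icc (1 / 4) 2) α isCompact_Icc hαs hsub
  refine ⟨c * (max C 0 * 4 ^ D), by positivity, fun ψ hψ hψs θ hθ l hl => ?_⟩
  have hψc : HasCompactSupport ψ :=
    HasCompactSupport.of_support_subset_isCompact isCompact_Icc hψs
  have hψi : Integrable fun t => |ψ t| := (hψ.integrable_of_hasCompactSupport hψc).abs
  set F : E → ℂ := fun x => (ψ (g x) * a x) • Complex.exp (((l * θ x : ℝ) : ℂ) * Complex.I) with hF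
  have hFc : Continuous F := by
    have h1 := hψ.comp hg.cont
    have h2 := ha.continuous
    have h3 : Continuous fun x => ψ (g x) := h1
    exact (h3.mul h2).smul (by fun_prop)
  have hFsub : Function.support F ⊆ Function.support a := fun x hx h => hx (by simp [hF, h])
  have hFs : HasCompactSupport F := hac.mono hFsub
  obtain ⟨-, hint⟩ := hcF F hFc hFs ((closure_mono hFsub).trans fun x hx => (hav hx).1)
  have key : ∀ t u, (|t| ^ D * (G u)⁻¹ ^ (D + 1)) • F ((t / G u) • A (1, u))
      = (|t| ^ D * ψ t) • (α (t, u) •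
        Complex.exp (((l * t * phase g A (θ, u) : ℝ) : ℂ) * Complex.I)) := by
    intro t u
    rcases le_or_gt t 0 with ht | ht
    · have h0 : a ((t / G u) • A (1, u)) = 0 := by
        by_contra h
        have := (hav (subset_tsupport a h)).1
        rw [hsm, A.symm_apply_apply] at this
        exact absurd this (not_lt.2 (div_nonpos_of_nonpos_of_nonneg ht (hGpos u).le))
      simp [hF, hα, h0]
    · have hgt : g ((t / G u) • A (1, u)) = t := by
        rw [hg.hom _ (div_pos ht (hGpos u))]
        exact div_mul_cancel₀ _ (hGpos u).ne'
      have hph : l * θ ((t / G u) • A (1, u)) = l * t * phase g A (θ, u) := by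
        simp only [phase, map_smul, smul_eq_mul, hG]; ring
      simp only [hF, hα, hgt, hph, smul_smul]
      congr 1
      ring
  have e : ∀ t, ∫ u, (|t| ^ D * (G u)⁻¹ ^ (D + 1)) • F ((t / G u) • A (1, u))
        ∂(addHaar : Measure X) = (|t| ^ D * ψ t) • ∫ u, α (t, u) •
        Complex.exp (((l * t * phase g A (θ, u) : ℝ) : ℂ) * Complex.I) ∂addHaar := fun t => by
    rw [← integral_smul]
    exact integral_congr_ae (Eventually.of_forall (key t))
  rw [hint.trans (congrArg (c • ·) (integral_congr_ae (Eventually.of_forall e)))]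
  rw [norm_smul, Real.norm_of_nonneg hc]
  have hb : ‖∫ t, (|t| ^ D * ψ t) • ∫ u, α (t, u) •
        Complex.exp (((l * t * phase g A (θ, u) : ℝ) : ℂ) * Complex.I) ∂(addHaar : Measure X)‖
      ≤ ∫ t, (max C 0 * 4 ^ D * l ^ (-(D : ℝ) / 2)) * |ψ t| := by
    refine norm_integral_le_of_norm_le (hψi.const_mul _) (Eventually.of_forall fun t => ?_)
    by_cases ht : ψ t = 0
    · simp [ht]
    have htI := hψs ht
    have ht0 : 0 < t := lt_of_lt_of_le (by norm_num) htI.1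
    have h1 := hC θ hθ t htI (l * t) (by positivity)
    rw [norm_smul, Real.norm_eq_abs, abs_mul, abs_pow, abs_abs, abs_of_pos ht0]
    have h2 : (l * t) ^ (-(D : ℝ) / 2) ≤ l ^ (-(D : ℝ) / 2) * 2 ^ D := by
      rw [Real.mul_rpow hl.le ht0.le]
      gcongr
      calc t ^ (-(D : ℝ) / 2) ≤ (1 / 4 : ℝ) ^ (-(D : ℝ) / 2) :=
            Real.rpow_le_rpow_of_nonpos (by norm_num) htI.1 (by
              have : (0 : ℝ) ≤ D := by positivity
              linarith)
        _ = 2 ^ D := by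
          rw [show (1 / 4 : ℝ) = 2 ^ (-2 : ℝ) by norm_num, ← Real.rpow_mul (by norm_num),
            ← Real.rpow_natCast]
          congr 1; ring
    have h4 : (4 : ℝ) ^ D = 2 ^ D * 2 ^ D := by rw [← mul_pow]; norm_num
    calc t ^ D * |ψ t| * _ ≤ (2 ^ D * |ψ t|) * (max C 0 * (l ^ (-(D : ℝ) / 2) * 2 ^ D)) := by
          gcongr
          · exact htI.2
          · refine h1.trans ?_
            gcongr
            exact le_max_left _ _
      _ = _ := by rw [h4]; ring
  calc c * _ ≤ c * _ := mul_le_mul_of_nonneg_left hb hc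
    _ = _ := by rw [integral_const_mul]; ring

end ProjectiveCoordinates

section GlobalDecay

open scoped Manifold

variable {E : Type*} [NormedAddCommGroup E] [NormedSpace ℝ E] {g : E → ℝ}

theorem IsGauge.map_zero (hg : IsGauge g) : g 0 = 0 := by
  have := hg.hom 2 (by norm_num) 0
  rw [smul_zero] at this
  linarith

theorem IsGauge.nonneg (hg : IsGauge g) (x : E) : 0 ≤ g x := by
  rcases eq_or_ne x 0 with rfl | hx
  · exact hg.map_zero.ge
  · exact (hg.pos x hx).le

variable [FiniteDimensional ℝ E]

theorem IsGauge.exists_lower (hg : IsGauge g) : ∃ m : ℝ, 0 < m ∧ ∀ x, m * ‖x‖ ≤ g x := by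
  rcases subsingleton_or_nontrivial E with hE | hE
  · exact ⟨1, one_pos, fun x => by rw [Subsingleton.elim x 0, hg.map_zero]; simp⟩
  obtain ⟨y, hy, hmin⟩ := (isCompact_sphere (0 : E) 1).exists_isMinOn
    (NormedSpace.sphere_nonempty.2 zero_le_one) hg.cont.continuousOn
  have hy0 : y ≠ 0 := by rintro rfl; simp at hy
  refine ⟨g y, hg.pos y hy0, fun x => ?_⟩
  rcases eq_or_ne x 0 with rfl | hx
  · simp [hg.map_zero]
  have hx' : 0 < ‖x‖ := norm_pos_iff.2 hx
  have h1 : g y ≤ g (‖x‖⁻¹ • x) := hmin (by simp [norm_smul, hx'.ne'])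
  rw [hg.hom _ (inv_pos.2 hx')] at h1
  rwa [mul_comm, ← le_inv_mul_iff₀ hx']

theorem IsGauge.isCompact_sublevel (hg : IsGauge g) (R : ℝ) : IsCompact {x | g x ≤ R} := by
  obtain ⟨m, hm, hmg⟩ := hg.exists_lower
  refine (isCompact_closedBall (0 : E) (R / m)).of_isClosed_subset
    (isClosed_le hg.cont continuous_const) fun x hx => ?_
  rw [mem_closedBall_zero_iff, le_div_iff₀ hm, mul_comm]
  exact (hmg x).trans hx

theorem IsGauge.continuous_annulus (hg : IsGauge g) {a : E → ℝ} (ha : ContinuousOn a {0}ᶜ)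
    {ψ : ℝ → ℝ} (hψ : Continuous ψ) (hψs : Function.support ψ ⊆ Icc (1 / 4) 2) :
    Continuous (fun x => ψ (g x) * a x) ∧ HasCompactSupport (fun x => ψ (g x) * a x) := by
  refine ⟨continuous_iff_continuousAt.2 fun x => ?_,
    HasCompactSupport.of_support_subset_isCompact (hg.isCompact_sublevel 2) fun x hx =>
      (hψs fun h => hx (by simp [h])).2⟩
  rcases eq_or_ne x 0 with rfl | hx
  · have : (fun x => ψ (g x) * a x) =ᶠ[𝓝 (0 : E)] fun _ => 0 := by
      have h1 : ∀ᶠ x in 𝓝 (0 : E), g x < 1 / 4 :=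
        hg.cont.continuousAt.eventually (gt_mem_nhds (by rw [hg.map_zero]; norm_num))
      filter_upwards [h1] with x hx
      have : ψ (g x) = 0 := by
        by_contra h
        exact absurd (hψs h).1 (not_le.2 hx)
      simp [this]
    exact continuousAt_const.congr this.symm
  · exact (hψ.comp hg.cont).continuousAt.mul
      (ha.continuousAt (isOpen_compl_singleton.mem_nhds hx))

variable [MeasurableSpace E] [BorelSpace E] (μ : Measure E) [μ.IsAddHaarMeasure]

theorem IsGauge.decay_near (hg : IsGauge g) {d : ℕ} (hd : 1 ≤ d) (hE : finrank ℝ E = d + 1)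
    {θ₀ : E →L[ℝ] ℝ} (hθ₀ : θ₀ ≠ 0) {a : E → ℝ} (ha : ContDiffOn ℝ ∞ a {0}ᶜ) :
    ∃ r : ℝ, 0 < r ∧ ∃ C : ℝ, 0 ≤ C ∧
      ∀ ψ : ℝ → ℝ, Continuous ψ → Function.support ψ ⊆ Icc (1 / 4) 2 →
      ∀ θ ∈ Metric.closedBall θ₀ r, ∀ l : ℝ, 0 < l →
        ‖∫ x, (ψ (g x) * a x) • Complex.exp (((l * θ x : ℝ) : ℂ) * Complex.I) ∂μ‖
          ≤ C * l ^ (-(d : ℝ) / 2) * ∫ t, |ψ t| := by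
  have hne : Nonempty (Fin d) := ⟨⟨0, hd⟩⟩
  have hloc : ∀ x : E, x ≠ 0 → ∃ V : Set E, IsOpen V ∧ x ∈ V ∧ ∃ r : ℝ, 0 < r ∧
      ∀ a : E → ℝ, ContDiff ℝ ∞ a → HasCompactSupport a → tsupport a ⊆ V →
      ∃ C : ℝ, 0 ≤ C ∧ ∀ ψ : ℝ → ℝ, Continuous ψ → Function.support ψ ⊆ Icc (1 / 4) 2 →
      ∀ θ ∈ Metric.closedBall θ₀ r, ∀ l : ℝ, 0 < l →
        ‖∫ x, (ψ (g x) * a x) • Complex.exp (((l * θ x : ℝ) : ℂ) * Complex.I) ∂μ‖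
          ≤ C * l ^ (-(d : ℝ) / 2) * ∫ t, |ψ t| := by
    intro x hx
    let A₀ : (ℝ × (Fin d → ℝ)) ≃L[ℝ] E := ContinuousLinearEquiv.ofFinrankEq (by simp [hE, add_comm])
    have h0 : A₀ (1, 0) ≠ 0 := chart_ne_zero A₀ 0
    obtain ⟨B, hB⟩ := SeparatingDual.exists_continuousLinearEquiv_apply_eq (R := ℝ) h0 hx
    have := hg.local_decay μ (A₀.trans B) hθ₀
    simpa [hB] using this
  choose! V hVo hxV r hr hV using hloc
  have hK : IsCompact {x : E | 1 / 4 ≤ g x ∧ g x ≤ 2} :=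
    (hg.isCompact_sublevel 2).inter_left (isClosed_le continuous_const hg.cont)
  have hK0 : ∀ x ∈ {x : E | 1 / 4 ≤ g x ∧ g x ≤ 2}, x ≠ 0 := by
    rintro x ⟨hx, -⟩ rfl
    rw [hg.map_zero] at hx
    norm_num at hx
  obtain ⟨s, hs, hcov⟩ := hK.elim_nhds_subcover V
    fun x hx => (hVo x (hK0 x hx)).mem_nhds (hxV x (hK0 x hx))
  let U : s → Set E := fun i => V i ∩ {x | 1 / 8 < g x ∧ g x < 3}
  have hs0 : ∀ i : s, (i : E) ≠ 0 := fun i => hK0 _ (hs i i.2)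
  have hUo : ∀ i, IsOpen (U i) := fun i => (hVo i (hs0 i)).inter
    ((isOpen_lt continuous_const hg.cont).inter (isOpen_lt hg.cont continuous_const))
  have hKU : {x : E | 1 / 4 ≤ g x ∧ g x ≤ 2} ⊆ ⋃ i, U i := by
    intro x hx
    obtain ⟨i, hi, hxi⟩ := mem_iUnion₂.1 (hcov hx)
    exact mem_iUnion.2 ⟨⟨i, hi⟩, hxi, lt_of_lt_of_le (by norm_num) hx.1,
      lt_of_le_of_lt hx.2 (by norm_num)⟩
  obtain ⟨ρ, hρ⟩ := SmoothPartitionOfUnity.exists_isSubordinate 𝓘(ℝ, E) hK.isClosed U hUo hKU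
  have hρs : ∀ i, ContDiff ℝ ∞ (ρ i) := fun i => (ρ i).contMDiff.contDiff
  have has : ∀ i, ContDiff ℝ ∞ (fun x => ρ i x * a x) := by
    intro i
    refine contDiff_iff_contDiffAt.2 fun x => ?_
    by_cases hx' : x ∈ tsupport (ρ i)
    swap
    · refine contDiffAt_const (c := (0 : ℝ)) |>.congr_of_eventuallyEq ?_
      filter_upwards [(isClosed_tsupport (ρ i)).isOpen_compl.mem_nhds hx'] with y hy
      simp [image_eq_zero_of_notMem_tsupport hy]
    have hx0 : x ≠ 0 := by
      rintro rfl
      have := (hρ i hx').2.1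
      rw [hg.map_zero] at this
      norm_num at this
    exact (hρs i).contDiffAt.mul (ha.contDiffAt (isOpen_compl_singleton.mem_nhds hx0))
  have hac : ∀ i, HasCompactSupport (fun x => ρ i x * a x) := fun i =>
    (hg.isCompact_sublevel 3).of_isClosed_subset (isClosed_tsupport _) fun x hx =>
      (hρ i (tsupport_mul_subset_left hx)).2.2.le
  have hats : ∀ i, tsupport (fun x => ρ i x * a x) ⊆ V i := fun i x hx =>
    (hρ i (tsupport_mul_subset_left hx)).1
  choose C hC0 hC using fun i : s => hV i (hs0 i) _ (has i) (hac i) (hats i)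
  obtain ⟨R, hR, hRr⟩ : ∃ R : ℝ, 0 < R ∧ ∀ i ∈ s, R ≤ r i := by
    have := s.finite_toSet
    have h := (Filter.eventually_all_finset s).2 (fun i hi =>
      (Ioc_mem_nhdsGT (hr i (hs0 ⟨i, hi⟩)) : ∀ᶠ R in 𝓝[>] (0 : ℝ), R ∈ Ioc 0 (r i)))
    obtain ⟨R, h1, h2⟩ := (h.and self_mem_nhdsWithin).exists
    exact ⟨R, h2, fun i hi => (h1 i hi).2⟩
  refine ⟨R, hR, ∑ i, C i, Finset.sum_nonneg fun i _ => hC0 i, fun ψ hψ hψs θ hθ l hl => ?_⟩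
  have hsum : ∀ x, (ψ (g x) * a x) • Complex.exp (((l * θ x : ℝ) : ℂ) * Complex.I)
      = ∑ i, (ψ (g x) * (ρ i x * a x)) • Complex.exp (((l * θ x : ℝ) : ℂ) * Complex.I) := by
    intro x
    rw [← Finset.sum_smul]
    congr 1
    by_cases hx : ψ (g x) = 0
    · simp [hx]
    have h1 := ρ.sum_eq_one (hψs hx)
    rw [finsum_eq_sum_of_fintype] at h1
    rw [← Finset.mul_sum, ← Finset.sum_mul, h1, one_mul]
  simp_rw [hsum]
  rw [integral_finsetSum]
  · rw [Finset.sum_mul, Finset.sum_mul]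
    refine (norm_sum_le _ _).trans (Finset.sum_le_sum fun i _ => ?_)
    exact hC i ψ hψ hψs θ (Metric.closedBall_subset_closedBall (hRr i i.2) hθ) l hl
  · intro i _
    obtain ⟨h1, h2⟩ := hg.continuous_annulus (has i).continuous.continuousOn hψ hψs
    refine Continuous.integrable_of_hasCompactSupport (h1.smul (by fun_prop)) ?_
    exact h2.smul_right

theorem IsGauge.decay (hg : IsGauge g) {d : ℕ} (hd : 1 ≤ d) (hE : finrank ℝ E = d + 1)
    {a : E → ℝ} (ha : ContDiffOn ℝ ∞ a {0}ᶜ) :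
    ∃ C : ℝ, 0 ≤ C ∧
      ∀ ψ : ℝ → ℝ, Continuous ψ → Function.support ψ ⊆ Icc (1 / 4) 2 →
      ∀ θ : E →L[ℝ] ℝ, θ ≠ 0 →
        ‖∫ x, (ψ (g x) * a x) • Complex.exp (((θ x : ℝ) : ℂ) * Complex.I) ∂μ‖
          ≤ C * ‖θ‖ ^ (-(d : ℝ) / 2) * ∫ t, |ψ t| := by
  have hnear := fun θ₀ (h : θ₀ ≠ 0) => hg.decay_near μ hd hE h ha
  choose! r hr C hC0 hC using hnear
  have hS0 : ∀ θ ∈ Metric.sphere (0 : E →L[ℝ] ℝ) 1, θ ≠ 0 := by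
    rintro θ hθ rfl; simp at hθ
  obtain ⟨s, hs, hcov⟩ := (isCompact_sphere (0 : E →L[ℝ] ℝ) 1).elim_nhds_subcover
    (fun θ => Metric.closedBall θ (r θ))
    fun θ hθ => Metric.closedBall_mem_nhds θ (hr θ (hS0 θ hθ))
  refine ⟨∑ θ ∈ s, C θ, Finset.sum_nonneg fun θ hθ => hC0 θ (hS0 θ (hs θ hθ)),
    fun ψ hψ hψs θ hθ => ?_⟩
  have hpos : 0 < ‖θ‖ := norm_pos_iff.2 hθ
  obtain ⟨θ₀, hθ₀, hmem⟩ := mem_iUnion₂.1 (hcov (show ‖θ‖⁻¹ • θ ∈ Metric.sphere (0 : E →L[ℝ] ℝ) 1 by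
    rw [mem_sphere_zero_iff_norm, norm_smul, norm_inv, norm_norm, inv_mul_cancel₀ hpos.ne']))
  have h := hC θ₀ (hS0 θ₀ (hs θ₀ hθ₀)) ψ hψ hψs _ hmem ‖θ‖ hpos
  have e : ∀ x, ‖θ‖ * (‖θ‖⁻¹ • θ) x = θ x := fun x => by
    simp [mul_inv_cancel_left₀ hpos.ne']
  simp_rw [e] at h
  refine h.trans ?_
  have hψ0 : 0 ≤ ∫ t, |ψ t| := integral_nonneg fun t => abs_nonneg (ψ t)
  gcongr
  exact Finset.single_le_sum (f := C) (fun θ hθ => hC0 θ (hS0 θ (hs θ hθ))) hθ₀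

end GlobalDecay

section RapidDecay

variable {E : Type*} [NormedAddCommGroup E] [NormedSpace ℝ E] {g : E → ℝ}

theorem IsGauge.eventually_annulus_eq_zero (hg : IsGauge g) (a : E → ℝ) {ψ : ℝ → ℝ}
    (hψs : Function.support ψ ⊆ Icc (1 / 4) 2) :
    (fun x => ψ (g x) * a x) =ᶠ[𝓝 (0 : E)] fun _ => 0 := by
  have h1 : ∀ᶠ x in 𝓝 (0 : E), g x < 1 / 4 :=
    hg.cont.continuousAt.eventually (gt_mem_nhds (by rw [hg.map_zero]; norm_num))
  filter_upwards [h1] with x hx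
  have : ψ (g x) = 0 := by
    by_contra h
    exact absurd (hψs h).1 (not_le.2 hx)
  simp [this]

theorem IsGauge.contDiff_annulus (hg : IsGauge g) {a : E → ℝ} (ha : ContDiffOn ℝ ∞ a {0}ᶜ)
    {ψ : ℝ → ℝ} (hψ : ContDiff ℝ ∞ ψ) (hψs : Function.support ψ ⊆ Icc (1 / 4) 2) :
    ContDiff ℝ ∞ (fun x => ψ (g x) * a x) := by
  refine contDiff_iff_contDiffAt.2 fun x => ?_
  rcases eq_or_ne x 0 with rfl | hx
  · exact contDiffAt_const.congr_of_eventuallyEq (hg.eventually_annulus_eq_zero a hψs)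
  · exact (hψ.contDiffAt.comp x (hg.contDiffAt hx)).mul
      (ha.contDiffAt (isOpen_compl_singleton.mem_nhds hx))

theorem support_deriv_subset_Icc {ψ : ℝ → ℝ} (hψs : Function.support ψ ⊆ Icc (1 / 4) 2) :
    Function.support (deriv ψ) ⊆ Icc (1 / 4) 2 :=
  (support_deriv_subset).trans (closure_minimal hψs isClosed_Icc)

theorem IsGauge.fderiv_annulus (hg : IsGauge g) {a : E → ℝ} (ha : ContDiffOn ℝ ∞ a {0}ᶜ)
    {ψ : ℝ → ℝ} (hψ : ContDiff ℝ ∞ ψ) (hψs : Function.support ψ ⊆ Icc (1 / 4) 2) (w x : E) :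
    fderiv ℝ (fun x => ψ (g x) * a x) x w
      = deriv ψ (g x) * (fderiv ℝ g x w * a x) + ψ (g x) * fderiv ℝ a x w := by
  rcases eq_or_ne x 0 with rfl | hx
  · have h1 : ψ (g 0) = 0 := by
      by_contra h
      have := (hψs h).1
      rw [hg.map_zero] at this
      norm_num at this
    have h2 : deriv ψ (g 0) = 0 := by
      by_contra h
      have := (support_deriv_subset_Icc hψs h).1
      rw [hg.map_zero] at this
      norm_num at this
    rw [(hg.eventually_annulus_eq_zero a hψs).fderiv_eq, h1, h2]
    simp
  · have hd1 := ((hψ.differentiable (by simp) (g x)).hasDerivAt).comp_hasFDerivAt x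
      ((hg.contDiffAt hx).differentiableAt (by simp)).hasFDerivAt
    have hd2 := ((ha.contDiffAt (isOpen_compl_singleton.mem_nhds hx)).differentiableAt
      (by simp)).hasFDerivAt
    have h3 : fderiv ℝ (fun x => ψ (g x) * a x) x = _ := (hd1.mul hd2).fderiv
    rw [h3]
    simp
    ring

theorem contDiffOn_fderiv_apply {a : E → ℝ} (ha : ContDiffOn ℝ ∞ a {0}ᶜ) (w : E) :
    ContDiffOn ℝ ∞ (fun x => fderiv ℝ a x w) {0}ᶜ :=
  (ha.fderiv_of_isOpen isOpen_compl_singleton (m := ∞) (by simp)).clm_apply contDiffOn_const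

variable [FiniteDimensional ℝ E] [MeasurableSpace E] [BorelSpace E]
  (μ : Measure E) [μ.IsAddHaarMeasure]

theorem IsGauge.rapid_decay (hg : IsGauge g) {d : ℕ} (hd : 1 ≤ d) (hE : finrank ℝ E = d + 1)
    (M : ℕ) {a : E → ℝ} (ha : ContDiffOn ℝ ∞ a {0}ᶜ) :
    ∃ C : ℝ, 0 ≤ C ∧
      ∀ ψ : ℝ → ℝ, ContDiff ℝ ∞ ψ → Function.support ψ ⊆ Icc (1 / 4) 2 →
      ∀ θ : E →L[ℝ] ℝ, θ ≠ 0 →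
        ‖∫ x, (ψ (g x) * a x) • Complex.exp (((θ x : ℝ) : ℂ) * Complex.I) ∂μ‖
          ≤ C * (‖θ‖⁻¹ ^ M * ‖θ‖ ^ (-(d : ℝ) / 2)) *
            ∑ m ∈ Finset.range (M + 1), ∫ t, |iteratedDeriv m ψ t| := by
  induction M generalizing a with
  | zero =>
    obtain ⟨C, hC0, hC⟩ := hg.decay μ hd hE ha
    exact ⟨C, hC0, fun ψ hψ hψs θ hθ => by simpa using hC ψ hψ.continuous hψs θ hθ⟩
  | succ M ih =>
    let b := finBasis ℝ E
    obtain ⟨K, hK, hKb⟩ := b.exists_opNorm_le (F := ℝ)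
    have h1 := fun i => ih ((contDiffOn_fderiv_apply hg.smooth (b i)).mul ha)
    have h2 := fun i => ih (contDiffOn_fderiv_apply ha (b i))
    choose C1 hC10 hC1 using h1
    choose C2 hC20 hC2 using h2
    refine ⟨2 * K * ∑ i, (C1 i + C2 i), mul_nonneg (by positivity)
      (Finset.sum_nonneg fun i _ => add_nonneg (hC10 i) (hC20 i)), fun ψ hψ hψs θ hθ => ?_⟩
    have hpos : 0 < ‖θ‖ := norm_pos_iff.2 hθ
    obtain ⟨i, hi⟩ : ∃ i, ‖θ‖ / (2 * K) < ‖θ (b i)‖ := by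
      by_contra! h
      have := hKb (by positivity) h
      rw [mul_div_assoc', mul_comm 2 K, mul_div_mul_left _ _ hK.ne'] at this
      linarith
    set w := b i with hw
    have hθw : 0 < ‖θ w‖ := lt_of_le_of_lt (by positivity) hi
    have hF := hg.contDiff_annulus ha hψ hψs
    have hFc := (hg.continuous_annulus ha.continuousOn hψ.continuous hψs).2
    have hibp := integral_ibp (μ := μ) hF hFc θ.contDiff w
    have hψ' : ContDiff ℝ ∞ (deriv ψ) := (contDiff_infty_iff_deriv.1 hψ).2
    have hψs' := support_deriv_subset_Icc hψs
    have e1 : ∫ x, (ψ (g x) * a x) • ((fderiv ℝ (θ : E → ℝ) x w : ℂ) *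
        Complex.exp (((θ x : ℝ) : ℂ) * Complex.I)) ∂μ = (θ w : ℂ) *
        ∫ x, (ψ (g x) * a x) • Complex.exp (((θ x : ℝ) : ℂ) * Complex.I) ∂μ := by
      rw [← integral_const_mul]
      refine integral_congr_ae (Eventually.of_forall fun x => ?_)
      simp only [ContinuousLinearMap.fderiv, Complex.real_smul]
      ring
    have hint : ∀ {a : E → ℝ} {ψ : ℝ → ℝ}, ContDiffOn ℝ ∞ a {0}ᶜ → ContDiff ℝ ∞ ψ →
        Function.support ψ ⊆ Icc (1 / 4) 2 → Integrable
        (fun x => (ψ (g x) * a x) • Complex.exp (((θ x : ℝ) : ℂ) * Complex.I)) μ := by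
      intro a ψ ha hψ hψs
      obtain ⟨h1, h2⟩ := hg.continuous_annulus ha.continuousOn hψ.continuous hψs
      exact Continuous.integrable_of_hasCompactSupport (h1.smul (by fun_prop)) h2.smul_right
    have e2 : ∫ x, fderiv ℝ (fun x => ψ (g x) * a x) x w •
        Complex.exp (((θ x : ℝ) : ℂ) * Complex.I) ∂μ
        = (∫ x, (deriv ψ (g x) * (fderiv ℝ g x w * a x)) •
            Complex.exp (((θ x : ℝ) : ℂ) * Complex.I) ∂μ)
          + ∫ x, (ψ (g x) * fderiv ℝ a x w) • Complex.exp (((θ x : ℝ) : ℂ) * Complex.I) ∂μ := by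
      rw [← integral_add (hint ((contDiffOn_fderiv_apply hg.smooth w).mul ha) hψ' hψs')
        (hint (contDiffOn_fderiv_apply ha w) hψ hψs)]
      refine integral_congr_ae (Eventually.of_forall fun x => ?_)
      simp only [hg.fderiv_annulus ha hψ hψs, add_smul]
    rw [e1, e2] at hibp
    have hn := congrArg norm hibp
    rw [norm_mul, norm_mul, Complex.norm_I, one_mul, Complex.norm_real] at hn
    set S := ∑ m ∈ Finset.range (M + 1 + 1), ∫ t, |iteratedDeriv m ψ t| with hS
    have hnn : ∀ (m : ℕ) (f : ℝ → ℝ), 0 ≤ ∫ t, |iteratedDeriv m f t| := fun m f =>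
      integral_nonneg fun t => abs_nonneg _
    have hS0 : 0 ≤ S := Finset.sum_nonneg fun m _ => hnn m ψ
    have hS1 : ∑ m ∈ Finset.range (M + 1), ∫ t, |iteratedDeriv m (deriv ψ) t| ≤ S := by
      rw [hS, Finset.sum_range_succ' (fun m => ∫ t, |iteratedDeriv m ψ t|) (M + 1)]
      simp only [iteratedDeriv_succ']
      exact le_add_of_nonneg_right (hnn 0 ψ)
    have hS2 : ∑ m ∈ Finset.range (M + 1), ∫ t, |iteratedDeriv m ψ t| ≤ S := by
      rw [hS, Finset.sum_range_succ _ (M + 1)]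
      exact le_add_of_nonneg_right (hnn _ ψ)
    set N := ‖θ‖⁻¹ ^ M * ‖θ‖ ^ (-(d : ℝ) / 2) with hN
    have hN0 : 0 ≤ N := by positivity
    set I := ‖∫ x, (ψ (g x) * a x) • Complex.exp (((θ x : ℝ) : ℂ) * Complex.I) ∂μ‖ with hI
    have hb : ‖θ w‖ * I ≤ (∑ i, (C1 i + C2 i)) * N * S := by
      rw [hn]
      calc _ ≤ _ := norm_add_le _ _
        _ ≤ C1 i * N * S + C2 i * N * S := by
            refine add_le_add ((hC1 i _ hψ' hψs' θ hθ).trans ?_) ((hC2 i _ hψ hψs θ hθ).trans ?_)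
            · exact mul_le_mul_of_nonneg_left hS1 (mul_nonneg (hC10 i) hN0)
            · exact mul_le_mul_of_nonneg_left hS2 (mul_nonneg (hC20 i) hN0)
        _ = (C1 i + C2 i) * N * S := by ring
        _ ≤ _ := by
            gcongr
            exact Finset.single_le_sum (f := fun i => C1 i + C2 i)
              (fun i _ => add_nonneg (hC10 i) (hC20 i)) (Finset.mem_univ i)
    have hI0 : 0 ≤ I := norm_nonneg _
    have hb2 : ‖θ‖ / (2 * K) * I ≤ (∑ i, (C1 i + C2 i)) * N * S :=
      (mul_le_mul_of_nonneg_right hi.le hI0).trans hb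
    calc I = (2 * K * ‖θ‖⁻¹) * (‖θ‖ / (2 * K) * I) := by field_simp
      _ ≤ (2 * K * ‖θ‖⁻¹) * ((∑ i, (C1 i + C2 i)) * N * S) :=
          mul_le_mul_of_nonneg_left hb2 (by positivity)
      _ = _ := by rw [hN, pow_succ]; ring

end RapidDecay

section Poisson

variable {n : ℕ}

/-- The integer vector `k`, as a real vector. -/
def toReal (k : Fin n → ℤ) : Fin n → ℝ := fun i => (k i : ℝ)

/-- The half-open unit cube with lower corner `k`. -/
def cube (k : Fin n → ℤ) : Set (Fin n → ℝ) := {x | ∀ i, x i ∈ Ioc (k i : ℝ) (k i + 1)}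

theorem cube_eq_pi (k : Fin n → ℤ) :
    cube k = Set.univ.pi fun i => Ioc (k i : ℝ) (k i + 1) := by
  ext x; simp [cube]

theorem measurableSet_cube (k : Fin n → ℤ) : MeasurableSet (cube k) := by
  rw [cube_eq_pi]
  exact MeasurableSet.univ_pi fun i => measurableSet_Ioc

theorem volume_cube (k : Fin n → ℤ) : volume (cube k) = 1 := by
  rw [cube_eq_pi, volume_pi_pi]
  simp

theorem mem_cube_iff {k : Fin n → ℤ} {x : Fin n → ℝ} : x ∈ cube k ↔ ∀ i, ⌈x i⌉ = k i + 1 := by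
  refine forall_congr' fun i => ?_
  rw [Int.ceil_eq_iff, mem_Ioc]
  push_cast
  rw [add_sub_cancel_right]

theorem pairwise_disjoint_cube : Pairwise (Function.onFun Disjoint (cube (n := n))) := by
  intro k l hkl
  refine Set.disjoint_left.2 fun x hx hy => hkl ?_
  ext i
  have h1 := mem_cube_iff.1 hx i
  have h2 := mem_cube_iff.1 hy i
  omega

theorem iUnion_cube : ⋃ k, cube (n := n) k = univ := by
  refine eq_univ_of_forall fun x => mem_iUnion.2 ⟨fun i => ⌈x i⌉ - 1, ?_⟩
  rw [mem_cube_iff]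
  intro i
  ring

theorem hasSum_integral_cube {F : Type*} [NormedAddCommGroup F] [NormedSpace ℝ F]
    {f : (Fin n → ℝ) → F} (hf : Integrable f) :
    HasSum (fun k => ∫ x in cube k, f x) (∫ x, f x) := by
  have := hasSum_integral_iUnion (μ := volume) measurableSet_cube
    (pairwise_disjoint_cube (n := n)) (f := f) hf.integrableOn
  rwa [iUnion_cube, setIntegral_univ] at this

theorem setIntegral_cube_eq {F : Type*} [NormedAddCommGroup F] [NormedSpace ℝ F]
    (f : (Fin n → ℝ) → F) (k : Fin n → ℤ) :
    ∫ x in cube k, f x = ∫ x in cube 0, f (x + toReal k) := by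
  have h1 : cube (0 : Fin n → ℤ) = (fun x => x + toReal k) ⁻¹' cube k := by
    ext x
    simp only [cube, toReal, mem_ofPred_eq, mem_preimage, Pi.add_apply, Pi.zero_apply,
      Int.cast_zero, mem_Ioc]
    refine forall_congr' fun i => and_congr ?_ ?_ <;> constructor <;> intro h <;> linarith
  rw [h1]
  exact ((measurePreserving_add_right volume (toReal k)).setIntegral_preimage_emb
    (measurableEmbedding_addRight _) f (cube k)).symm

theorem finite_norm_toReal_le (B : ℝ) : {k : Fin n → ℤ | ‖toReal k‖ ≤ B}.Finite := by
  refine (Set.finite_Icc (fun _ : Fin n => -⌈B⌉) (fun _ => ⌈B⌉)).subset fun k hk => ?_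
  have h3 : ∀ i, |k i| ≤ ⌈B⌉ := fun i => by
    have : |(k i : ℝ)| ≤ ⌈B⌉ := ((norm_le_pi_norm (toReal k) i).trans hk).trans (Int.le_ceil _)
    exact_mod_cast this
  exact ⟨fun i => (abs_le.1 (h3 i)).1, fun i => (abs_le.1 (h3 i)).2⟩

theorem finite_shift_of_hasCompactSupport {H : (Fin n → ℝ) → ℝ} (hH : HasCompactSupport H) (R : ℝ) :
    {k : Fin n → ℤ | ∃ x, ‖x‖ ≤ R ∧ H (x + toReal k) ≠ 0}.Finite := by
  obtain ⟨B, hB⟩ := hH.isBounded.exists_norm_le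
  refine (finite_norm_toReal_le (B + R)).subset ?_
  rintro k ⟨x, hx, hk⟩
  have h1 := hB _ (subset_tsupport H hk)
  calc ‖toReal k‖ = ‖(x + toReal k) - x‖ := by rw [add_sub_cancel_left]
    _ ≤ _ := norm_sub_le _ _
    _ ≤ _ := add_le_add h1 hx

/-- The sum of `H` over the translates of `x` by integer vectors. -/
noncomputable def periodization (H : (Fin n → ℝ) → ℝ) (x : Fin n → ℝ) : ℝ :=
  ∑' k : Fin n → ℤ, H (x + toReal k)

theorem periodization_eq_sum {H : (Fin n → ℝ) → ℝ} (hH : HasCompactSupport H) (R : ℝ) :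
    ∃ s : Finset (Fin n → ℤ), ∀ x, ‖x‖ ≤ R →
      (∀ k ∉ s, H (x + toReal k) = 0) ∧ periodization H x = ∑ k ∈ s, H (x + toReal k) := by
  refine ⟨(finite_shift_of_hasCompactSupport hH R).toFinset, fun x hx => ?_⟩
  have : ∀ k ∉ (finite_shift_of_hasCompactSupport hH R).toFinset, H (x + toReal k) = 0 := by
    intro k hk
    by_contra h
    exact hk (by simpa using ⟨x, hx, h⟩)
  exact ⟨this, tsum_eq_sum this⟩

theorem continuous_periodization {H : (Fin n → ℝ) → ℝ} (hH : HasCompactSupport H)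
    (hc : Continuous H) : Continuous (periodization H) := by
  refine continuous_iff_continuousAt.2 fun x => ?_
  obtain ⟨s, hs⟩ := periodization_eq_sum hH (‖x‖ + 1)
  have h1 : ContinuousAt (fun y => ∑ k ∈ s, H (y + toReal k)) x := by fun_prop
  refine h1.congr ?_
  filter_upwards [Metric.ball_mem_nhds x one_pos] with y hy
  refine ((hs y ?_).2).symm
  have := norm_sub_norm_le y x
  rw [mem_ball_iff_norm] at hy
  linarith

theorem periodization_add (H : (Fin n → ℝ) → ℝ) (x : Fin n → ℝ) (l : Fin n → ℤ) :
    periodization H (x + toReal l) = periodization H x := by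
  unfold periodization
  rw [← (Equiv.addLeft l).tsum_eq (fun k => H (x + toReal k))]
  refine tsum_congr fun k => ?_
  congr 1
  ext i
  simp [toReal, add_assoc]

/-- The periodization, as a function on the torus. -/
theorem exists_torus_periodization {H : (Fin n → ℝ) → ℝ} (hH : HasCompactSupport H)
    (hc : Continuous H) : ∃ f : C(UnitAddTorus (Fin n), ℂ),
      ∀ x : Fin n → ℝ, f (fun i => (x i : UnitAddCircle)) = (periodization H x : ℂ) := by
  have hq : IsOpenQuotientMap (Pi.map fun (_ : Fin n) (y : ℝ) => (y : UnitAddCircle)) :=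
    IsOpenQuotientMap.piMap fun _ => QuotientAddGroup.isOpenQuotientMap_mk
  have hq' : IsOpenQuotientMap (fun (x : Fin n → ℝ) (i : Fin n) => (x i : UnitAddCircle)) := hq
  set σ := Function.surjInv hq'.surjective with hσ
  set f : UnitAddTorus (Fin n) → ℂ := fun t => (periodization H (σ t) : ℂ) with hf
  have hfx : ∀ x : Fin n → ℝ, f (fun i => (x i : UnitAddCircle)) = (periodization H x : ℂ) := by
    intro x
    have h1 := Function.surjInv_eq hq'.surjective (fun i => (x i : UnitAddCircle))
    have h2 : ∀ i, ∃ l : ℤ, σ (fun i => (x i : UnitAddCircle)) i = x i + l := by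
      intro i
      have h3 : ((σ (fun i => (x i : UnitAddCircle)) i - x i : ℝ) : UnitAddCircle) = 0 := by
        rw [AddCircle.coe_sub, sub_eq_zero]
        exact congrFun h1 i
      obtain ⟨l, hl⟩ := (AddCircle.coe_eq_zero_iff 1).1 h3
      refine ⟨l, ?_⟩
      simp only [zsmul_eq_mul, mul_one] at hl
      linarith
    choose l hl using h2
    have h3 : σ (fun i => (x i : UnitAddCircle)) = x + toReal l := by
      ext i; simp [hl, toReal]
    simp only [hf]
    rw [h3, periodization_add]
  refine ⟨⟨f, ?_⟩, hfx⟩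
  rw [hq'.isQuotientMap.continuous_iff]
  have : f ∘ (fun (x : Fin n → ℝ) (i : Fin n) => (x i : UnitAddCircle))
      = fun x => (periodization H x : ℂ) := funext hfx
  rw [this]
  exact Complex.continuous_ofReal.comp (continuous_periodization hH hc)

theorem mFourier_coe (m : Fin n → ℤ) (x : Fin n → ℝ) :
    UnitAddTorus.mFourier m (fun i => (x i : UnitAddCircle))
      = Complex.exp (((∑ i, 2 * Real.pi * m i * x i : ℝ) : ℂ) * Complex.I) := by
  simp only [UnitAddTorus.mFourier, ContinuousMap.coe_mk, fourier_coe_apply]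
  rw [← Complex.exp_sum]
  congr 1
  push_cast
  rw [Finset.sum_mul]
  refine Finset.sum_congr rfl fun i _ => ?_
  ring

theorem mFourierCoeff_periodization {H : (Fin n → ℝ) → ℝ} (hH : HasCompactSupport H)
    (hc : Continuous H) {f : C(UnitAddTorus (Fin n), ℂ)}
    (hf : ∀ x : Fin n → ℝ, f (fun i => (x i : UnitAddCircle)) = (periodization H x : ℂ))
    (m : Fin n → ℤ) :
    UnitAddTorus.mFourierCoeff f m
      = ∫ x, H x • Complex.exp (((∑ i, 2 * Real.pi * (-m) i * x i : ℝ) : ℂ) * Complex.I) := by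
  set e : (Fin n → ℝ) → ℂ := fun x =>
    Complex.exp (((∑ i, 2 * Real.pi * (-m) i * x i : ℝ) : ℂ) * Complex.I) with he
  have hec : Continuous e := by
    simp only [he]; fun_prop
  have hee : ∀ x k, e (x + toReal k) = e x := by
    intro x k
    rw [he]
    simp only
    rw [← mFourier_coe, ← mFourier_coe]
    congr 1
    ext i
    simp [toReal]
  rw [UnitAddTorus.mFourierCoeff_eq_integral _ _ 0]
  have hcube : {x : Fin n → ℝ | ∀ i, x i ∈ Ioc ((0 : Fin n → ℝ) i) ((0 : Fin n → ℝ) i + 1)}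
      = cube 0 := by ext x; simp [cube]
  rw [hcube]
  have hint : Integrable (fun x => H x • e x) :=
    (hc.smul hec).integrable_of_hasCompactSupport hH.smul_right
  rw [← (hasSum_integral_cube hint).tsum_eq]
  have hnorm : ∀ x ∈ cube (0 : Fin n → ℤ), ‖x‖ ≤ 1 := by
    intro x hx
    rw [pi_norm_le_iff_of_nonneg zero_le_one]
    intro i
    have := hx i
    simp only [Pi.zero_apply, Int.cast_zero, zero_add, mem_Ioc] at this
    rw [Real.norm_eq_abs, abs_le]
    constructor <;> linarith
  obtain ⟨s, hs⟩ := periodization_eq_sum hH 1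
  rw [tsum_eq_sum (s := s)]
  · simp_rw [setIntegral_cube_eq (fun x => H x • e x)]
    rw [← integral_finsetSum]
    · refine setIntegral_congr_fun (measurableSet_cube 0) fun x hx => ?_
      simp only [hf, mFourier_coe, (hs x (hnorm x hx)).2]
      rw [smul_eq_mul, mul_comm]
      push_cast
      rw [Finset.sum_mul]
      refine Finset.sum_congr rfl fun k _ => ?_
      rw [hee, Complex.real_smul]
      simp [he]
    · intro k _
      have := hint.comp_add_right (toReal k)
      exact this.integrableOn
  · intro k hk
    rw [setIntegral_cube_eq]
    rw [setIntegral_congr_fun (g := fun _ => 0) (measurableSet_cube 0) fun x hx => ?_]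
    · simp
    · simp [(hs x (hnorm x hx)).1 k hk]

theorem norm_tsum_sub_integral_le {H : (Fin n → ℝ) → ℝ} (hH : HasCompactSupport H)
    (hc : Continuous H) {b : (Fin n → ℤ) → ℝ} (hb : Summable b) (hb0 : 0 ≤ b 0)
    (hbm : ∀ m ≠ 0, ‖∫ x, H x • Complex.exp
      (((∑ i, 2 * Real.pi * m i * x i : ℝ) : ℂ) * Complex.I)‖ ≤ b m) :
    |∑' k : Fin n → ℤ, H (toReal k) - ∫ x, H x| ≤ ∑' m, b m := by
  obtain ⟨f, hf⟩ := exists_torus_periodization hH hc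
  have hcoef := mFourierCoeff_periodization hH hc hf
  have hbneg : Summable fun m => b (-m) := (Equiv.neg (Fin n → ℤ)).summable_iff.2 hb
  have hle : ∀ m ≠ 0, ‖UnitAddTorus.mFourierCoeff f m‖ ≤ b (-m) := fun m hm => by
    rw [hcoef]
    exact hbm (-m) (neg_ne_zero.2 hm)
  have h0 : UnitAddTorus.mFourierCoeff f 0 = ((∫ x, H x : ℝ) : ℂ) := by
    rw [hcoef, ← integral_complex_ofReal]
    simp
  have hs : Summable (UnitAddTorus.mFourierCoeff f) := by
    refine Summable.of_norm_bounded_eventually hbneg ?_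
    filter_upwards [(Set.finite_singleton (0 : Fin n → ℤ)).compl_mem_cofinite] with m hm
    exact hle m hm
  have hsum := UnitAddTorus.hasSum_mFourier_series_apply_of_summable hs 0
  have hf0 : f 0 = ((∑' k : Fin n → ℤ, H (toReal k) : ℝ) : ℂ) := by
    have := hf 0
    simp only [Pi.zero_apply, periodization, zero_add] at this
    exact this
  have hm0 : ∀ m, UnitAddTorus.mFourier m (0 : UnitAddTorus (Fin n)) = 1 := fun m => by
    simp [UnitAddTorus.mFourier]
  simp only [hm0, smul_eq_mul, mul_one] at hsum
  have h2 := hsum.update 0 0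
  rw [h0, hf0, zero_sub, neg_add_eq_sub, ← Complex.ofReal_sub] at h2
  have h3 := tsum_of_norm_bounded (f := Function.update (UnitAddTorus.mFourierCoeff f) 0 0)
    (g := fun m => b (-m)) (hbneg.hasSum) (fun m => by
      rcases eq_or_ne m 0 with rfl | hm
      · simpa using hb0
      · simpa [Function.update_of_ne hm] using hle m hm)
  rw [h2.tsum_eq, Complex.norm_real, Real.norm_eq_abs] at h3
  refine h3.trans_eq ?_
  exact (Equiv.neg (Fin n → ℤ)).tsum_eq b

end Poisson

section DecayProfile

/-- The radial profile which dominates the Fourier coefficients. -/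
noncomputable def decayProfile (d : ℕ) (t : ℝ) : ℝ :=
  t ^ (-(1 + (d : ℝ) / 2)) * min 1 (t⁻¹ ^ (d + 1))

variable {d : ℕ}

theorem decayProfile_nonneg {t : ℝ} (ht : 0 ≤ t) : 0 ≤ decayProfile d t := by
  unfold decayProfile; positivity

theorem decayProfile_zero : decayProfile d 0 = 0 := by
  unfold decayProfile
  rw [Real.zero_rpow, zero_mul]
  have : (0 : ℝ) ≤ d / 2 := by positivity
  linarith

theorem measurable_decayProfile : Measurable (decayProfile d) := by
  unfold decayProfile
  fun_prop

theorem decayProfile_anti {s t : ℝ} (hs : 0 < s) (hst : s ≤ t) :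
    decayProfile d t ≤ decayProfile d s := by
  unfold decayProfile
  have ht : 0 < t := hs.trans_le hst
  refine mul_le_mul (Real.rpow_le_rpow_of_nonpos hs hst ?_) ?_ (by positivity) (by positivity)
  · have : (0 : ℝ) ≤ d / 2 := by positivity
    linarith
  · gcongr

theorem decayProfile_le_two_mul {t : ℝ} (ht : 0 < t) :
    decayProfile d t ≤ 2 ^ (1 + (d : ℝ) / 2) * 2 ^ (d + 1) * decayProfile d (2 * t) := by
  unfold decayProfile
  rw [Real.mul_rpow zero_le_two ht.le, mul_inv, mul_pow]
  have h1 : min 1 (t⁻¹ ^ (d + 1)) ≤ 2 ^ (d + 1) * min 1 (2⁻¹ ^ (d + 1) * t⁻¹ ^ (d + 1)) := by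
    rw [mul_min_of_nonneg _ _ (by positivity), ← mul_assoc, ← mul_pow]
    norm_num
    left
    exact one_le_pow₀ one_le_two
  have h2 : (2 : ℝ) ^ (1 + (d : ℝ) / 2) * 2 ^ (-(1 + (d : ℝ) / 2)) = 1 := by
    rw [← Real.rpow_add two_pos]; simp
  calc _ ≤ t ^ (-(1 + (d : ℝ) / 2)) *
        (2 ^ (d + 1) * min 1 (2⁻¹ ^ (d + 1) * t⁻¹ ^ (d + 1))) := by gcongr
    _ = ((2 : ℝ) ^ (1 + (d : ℝ) / 2) * 2 ^ (-(1 + (d : ℝ) / 2))) * (t ^ (-(1 + (d : ℝ) / 2)) *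
        (2 ^ (d + 1) * min 1 (2⁻¹ ^ (d + 1) * t⁻¹ ^ (d + 1)))) := by rw [h2, one_mul]
    _ = _ := by ring

theorem integrable_decayProfile (hd : 1 ≤ d) :
    Integrable fun x : Fin (d + 1) → ℝ => decayProfile d ‖x‖ := by
  have hd' : (1 : ℝ) ≤ d := by exact_mod_cast hd
  rw [integrable_fun_norm_addHaar volume (f := decayProfile d), finrank_fin_fun,
    Nat.add_sub_cancel, ← Ioc_union_Ioi_eq_Ioi zero_le_one]
  have hmeas : Measurable fun t : ℝ => t ^ d • decayProfile d t :=
    (measurable_id.pow_const d).smul measurable_decayProfile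
  refine IntegrableOn.union ?_ ?_
  · have h1 : IntegrableOn (fun t : ℝ => t ^ ((d : ℝ) / 2 - 1)) (Ioc 0 1) :=
      (intervalIntegrable_iff_integrableOn_Ioc_of_le zero_le_one).1
        (intervalIntegral.intervalIntegrable_rpow' (by linarith))
    refine h1.mono' hmeas.aestronglyMeasurable ?_
    filter_upwards [ae_restrict_mem measurableSet_Ioc] with t ht
    have ht0 : 0 < t := ht.1
    rw [Real.norm_of_nonneg (smul_nonneg (by positivity) (decayProfile_nonneg ht0.le)),
      smul_eq_mul, decayProfile, ← Real.rpow_natCast t d, ← mul_assoc, ← Real.rpow_add ht0]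
    refine (mul_le_of_le_one_right (by positivity) (min_le_left _ _)).trans_eq ?_
    congr 1; ring
  · have h1 : IntegrableOn (fun t : ℝ => t ^ (-((d : ℝ) / 2) - 2)) (Ioi 1) :=
      integrableOn_Ioi_rpow_of_lt (by linarith) one_pos
    refine h1.mono' hmeas.aestronglyMeasurable ?_
    filter_upwards [ae_restrict_mem measurableSet_Ioi] with t ht
    have ht0 : 0 < t := one_pos.trans ht
    rw [Real.norm_of_nonneg (smul_nonneg (by positivity) (decayProfile_nonneg ht0.le)),
      smul_eq_mul, decayProfile]
    calc _ ≤ t ^ d * (t ^ (-(1 + (d : ℝ) / 2)) * t⁻¹ ^ (d + 1)) := by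
          gcongr; exact min_le_right _ _
      _ = _ := by
        rw [inv_pow, ← Real.rpow_natCast t d, ← Real.rpow_natCast t (d + 1), ← Real.rpow_neg ht0.le,
          ← Real.rpow_add ht0, ← Real.rpow_add ht0]
        congr 1; push_cast; ring

theorem toReal_eq_zero {n : ℕ} {m : Fin n → ℤ} : toReal m = 0 ↔ m = 0 := by
  constructor
  · intro h; ext i; have := congrFun h i; simpa [toReal] using this
  · rintro rfl; ext i; simp [toReal]

theorem one_le_norm_toReal {n : ℕ} {m : Fin n → ℤ} (hm : m ≠ 0) : 1 ≤ ‖toReal m‖ := by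
  obtain ⟨i, hi⟩ := Function.ne_iff.1 hm
  refine le_trans ?_ (norm_le_pi_norm (toReal m) i)
  have : 1 ≤ |m i| := Int.one_le_abs hi
  simp only [toReal, Real.norm_eq_abs]
  exact_mod_cast this

theorem norm_le_two_mul_of_mem_cube {n : ℕ} {m : Fin n → ℤ} (hm : m ≠ 0) {x : Fin n → ℝ}
    (hx : x ∈ cube m) : ‖x‖ ≤ 2 * ‖toReal m‖ := by
  have h1 := one_le_norm_toReal hm
  have h2 : ‖x - toReal m‖ ≤ 1 := by
    rw [pi_norm_le_iff_of_nonneg zero_le_one]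
    intro i
    have := hx i
    rw [mem_Ioc] at this
    simp only [Pi.sub_apply, toReal]
    rw [Real.norm_eq_abs, abs_le]
    constructor <;> linarith
  have := norm_le_insert' x (toReal m)
  linarith

theorem exists_summable_decayProfile (hd : 1 ≤ d) : ∃ C : ℝ, 0 ≤ C ∧ ∀ q : ℝ, 0 < q →
    Summable (fun m : Fin (d + 1) → ℤ => decayProfile d (q * ‖toReal m‖)) ∧
    ∑' m : Fin (d + 1) → ℤ, decayProfile d (q * ‖toReal m‖) ≤ C * q⁻¹ ^ (d + 1) := by
  set K : ℝ := 2 ^ (1 + (d : ℝ) / 2) * 2 ^ (d + 1) with hK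
  have hK0 : 0 ≤ K := by positivity
  have hint := integrable_decayProfile hd
  have hI0 : 0 ≤ ∫ x : Fin (d + 1) → ℝ, decayProfile d ‖x‖ :=
    integral_nonneg fun x => decayProfile_nonneg (norm_nonneg x)
  refine ⟨K * ∫ x : Fin (d + 1) → ℝ, decayProfile d ‖x‖, by positivity, fun q hq => ?_⟩
  have hnorm : ∀ x : Fin (d + 1) → ℝ, ‖q • x‖ = q * ‖x‖ := fun x => by
    rw [norm_smul, Real.norm_of_nonneg hq.le]
  have hintq : Integrable fun x : Fin (d + 1) → ℝ => decayProfile d (q * ‖x‖) := by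
    simpa only [hnorm] using hint.comp_smul hq.ne'
  have hintq' : ∫ x : Fin (d + 1) → ℝ, decayProfile d (q * ‖x‖)
      = q⁻¹ ^ (d + 1) * ∫ x : Fin (d + 1) → ℝ, decayProfile d ‖x‖ := by
    have := integral_comp_smul volume (fun x : Fin (d + 1) → ℝ => decayProfile d ‖x‖) q
    simp only [hnorm, finrank_fin_fun, smul_eq_mul] at this
    rw [this, abs_of_nonneg (by positivity), inv_pow]
  have hsum := (hasSum_integral_cube hintq).mul_left K
  have hpt : ∀ m : Fin (d + 1) → ℤ, decayProfile d (q * ‖toReal m‖)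
      ≤ K * ∫ x in cube m, decayProfile d (q * ‖x‖) := by
    intro m
    rcases eq_or_ne m 0 with rfl | hm
    · rw [toReal_eq_zero.2 rfl, norm_zero, mul_zero, decayProfile_zero]
      exact mul_nonneg hK0 (integral_nonneg fun x => decayProfile_nonneg (by positivity))
    · have hm1 := one_le_norm_toReal hm
      have h1 : decayProfile d (q * ‖toReal m‖)
          = ∫ x in cube m, decayProfile d (q * ‖toReal m‖) := by
        rw [setIntegral_const, measureReal_def, volume_cube]; simp
      rw [h1, ← integral_const_mul]
      refine setIntegral_mono_on_ae ?_ (hintq.const_mul K).integrableOn (measurableSet_cube m) ?_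
      · exact integrableOn_const (by rw [volume_cube]; simp)
      · filter_upwards [compl_mem_ae_iff.2 (measure_singleton (0 : Fin (d + 1) → ℝ))] with x hx hxm
        have hx0 : 0 < ‖x‖ := norm_pos_iff.2 hx
        refine (decayProfile_le_two_mul (by positivity)).trans ?_
        refine mul_le_mul_of_nonneg_left (decayProfile_anti (by positivity) ?_) hK0
        have := norm_le_two_mul_of_mem_cube hm hxm
        nlinarith
  have hs : Summable fun m : Fin (d + 1) → ℤ => decayProfile d (q * ‖toReal m‖) :=
    Summable.of_nonneg_of_le (fun m => decayProfile_nonneg (by positivity)) hpt hsum.summable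
  refine ⟨hs, (hs.tsum_le_tsum hpt hsum.summable).trans_eq ?_⟩
  rw [hsum.tsum_eq, hintq']
  ring

end DecayProfile

section SmoothedCount

variable {n : ℕ}

/-- The linear form `x ↦ 2π⟨m, x⟩`. -/
noncomputable def dualForm (m : Fin n → ℤ) : (Fin n → ℝ) →L[ℝ] ℝ :=
  ∑ i, (2 * Real.pi * m i) • ContinuousLinearMap.proj i

theorem dualForm_apply (m : Fin n → ℤ) (x : Fin n → ℝ) :
    dualForm m x = ∑ i, 2 * Real.pi * m i * x i := by
  simp [dualForm]

theorem norm_toReal_le_norm_dualForm (m : Fin n → ℤ) : ‖toReal m‖ ≤ ‖dualForm m‖ := by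
  rw [pi_norm_le_iff_of_nonneg (norm_nonneg _)]
  intro i
  have h1 := (dualForm m).le_opNorm (Pi.single i 1)
  have h2 : dualForm m (Pi.single i 1) = 2 * Real.pi * m i := by
    rw [dualForm_apply, Finset.sum_eq_single i]
    · simp
    · intro j _ hj; simp [Pi.single_eq_of_ne hj]
    · simp
  have h3 : ‖(Pi.single i 1 : Fin n → ℝ)‖ ≤ 1 := by
    rw [Pi.norm_single]; simp
  rw [h2, norm_mul, Real.norm_of_nonneg (by positivity)] at h1
  have h4 : ‖dualForm m‖ * ‖(Pi.single i 1 : Fin n → ℝ)‖ ≤ ‖dualForm m‖ :=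
    mul_le_of_le_one_right (norm_nonneg _) h3
  have h5 : ‖(m i : ℝ)‖ ≤ 2 * Real.pi * ‖(m i : ℝ)‖ :=
    le_mul_of_one_le_left (norm_nonneg _) (by linarith [Real.pi_gt_three])
  exact h5.trans (h1.trans h4)

theorem integral_scaled_mul_exp {F : (Fin n → ℝ) → ℝ} {R : ℝ} (hR : 0 < R) (m : Fin n → ℤ) :
    ∫ x, F (R⁻¹ • x) • Complex.exp (((∑ i, 2 * Real.pi * m i * x i : ℝ) : ℂ) * Complex.I)
      = (R ^ n) • ∫ x, F x • Complex.exp ((((R • dualForm m) x : ℝ) : ℂ) * Complex.I) := by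
  have h := integral_comp_smul volume (fun x : Fin n → ℝ =>
    F x • Complex.exp ((((R • dualForm m) x : ℝ) : ℂ) * Complex.I)) R⁻¹
  rw [finrank_fin_fun, inv_pow, inv_inv, abs_of_nonneg (by positivity)] at h
  rw [← h]
  refine integral_congr_ae (ae_of_all _ fun x => ?_)
  simp only [_root_.smul_apply, map_smul, smul_eq_mul, ← mul_assoc, inv_mul_cancel₀ hR.ne',
    one_mul, dualForm_apply]

theorem integral_scaled {F : (Fin n → ℝ) → ℝ} {R : ℝ} (hR : 0 < R) :
    ∫ x, F (R⁻¹ • x) = R ^ n * ∫ x, F x := by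
  have h := integral_comp_smul volume F R⁻¹
  rwa [finrank_fin_fun, inv_pow, inv_inv, abs_of_nonneg (by positivity), smul_eq_mul] at h

theorem IsGauge.smoothed_count {d : ℕ} (hd : 1 ≤ d) {g : (Fin (d + 1) → ℝ) → ℝ} (hg : IsGauge g)
    {a : (Fin (d + 1) → ℝ) → ℝ} (ha : ContDiffOn ℝ ∞ a {0}ᶜ)
    (hhom : ∀ t : ℝ, 0 < t → ∀ x, a (t • x) = a x) :
    ∃ C : ℝ, 0 ≤ C ∧ ∀ (A δ R : ℝ) (ψ : ℝ → ℝ), 0 ≤ A → 0 < δ → δ ≤ 1 → 0 < R →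
      ContDiff ℝ ∞ ψ → Function.support ψ ⊆ Icc (1 / 4) 2 →
      (∀ j ≤ d + 2, ∫ t, |iteratedDeriv j ψ t| ≤ A * δ⁻¹ ^ (j - 1)) →
      |∑' k : Fin (d + 1) → ℤ, ψ (R⁻¹ * g (toReal k)) * a (toReal k)
        - R ^ (d + 1) * ∫ x, ψ (g x) * a x| ≤ C * A * δ ^ (-(d : ℝ) / 2) := by
  have hE : finrank ℝ (Fin (d + 1) → ℝ) = d + 1 := finrank_fin_fun ℝ
  obtain ⟨C₁, hC₁, h₁⟩ := hg.rapid_decay volume hd hE 1 ha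
  obtain ⟨C₂, hC₂, h₂⟩ := hg.rapid_decay volume hd hE (d + 2) ha
  obtain ⟨C₃, hC₃, h₃⟩ := exists_summable_decayProfile hd
  set C₀ : ℝ := C₁ * 2 + C₂ * (d + 3) with hC₀
  have hC₀0 : 0 ≤ C₀ := by positivity
  refine ⟨C₀ * C₃, by positivity, fun A δ R ψ hA hδ hδ1 hR hψ hψs hψj => ?_⟩
  obtain ⟨hc, hs⟩ := hg.continuous_annulus ha.continuousOn hψ.continuous hψs
  set F : (Fin (d + 1) → ℝ) → ℝ := fun x => ψ (g x) * a x with hF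
  have hRi : 0 < R⁻¹ := inv_pos.2 hR
  have hq : 0 < R * δ := mul_pos hR hδ
  have hδi : 1 ≤ δ⁻¹ := (one_le_inv₀ hδ).2 hδ1
  obtain ⟨hsum, hle⟩ := h₃ (R * δ) hq
  have hFT : ∀ m ≠ 0, ‖∫ x, F (R⁻¹ • x) • Complex.exp
      (((∑ i, 2 * Real.pi * m i * x i : ℝ) : ℂ) * Complex.I)‖
      ≤ R ^ (d + 1) * C₀ * A * δ ^ (1 + (d : ℝ) / 2) * decayProfile d (R * δ * ‖toReal m‖) := by
    intro m hm
    have hm1 := one_le_norm_toReal hm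
    set r : ℝ := R * ‖toReal m‖ with hr
    have hr0 : 0 < r := by positivity
    set θ := R • dualForm m with hθ
    have hrθ : r ≤ ‖θ‖ := by
      rw [hθ, norm_smul, Real.norm_of_nonneg hR.le]
      exact mul_le_mul_of_nonneg_left (norm_toReal_le_norm_dualForm m) hR.le
    have hθ0 : θ ≠ 0 := norm_pos_iff.1 (hr0.trans_le hrθ)
    have hθi : ‖θ‖⁻¹ ≤ r⁻¹ := inv_anti₀ hr0 hrθ
    have hθp : ‖θ‖ ^ (-(d : ℝ) / 2) ≤ r ^ (-(d : ℝ) / 2) :=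
      Real.rpow_le_rpow_of_nonpos hr0 hrθ (by
        have : (0 : ℝ) ≤ d := by positivity
        linarith)
    have hb1 : ‖∫ x, F x • Complex.exp (((θ x : ℝ) : ℂ) * Complex.I)‖
        ≤ C₀ * A * (r⁻¹ * r ^ (-(d : ℝ) / 2)) := by
      refine (h₁ ψ hψ hψs θ hθ0).trans ?_
      have hS : ∑ j ∈ Finset.range (1 + 1), ∫ t, |iteratedDeriv j ψ t| ≤ 2 * A := by
        rw [Finset.sum_range_succ, Finset.sum_range_one]
        have e0 := hψj 0 (by omega)
        have e1 := hψj 1 (by omega)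
        simp only [Nat.zero_sub, Nat.sub_self, pow_zero, mul_one] at e0 e1
        linarith
      calc _ ≤ C₁ * (r⁻¹ ^ 1 * r ^ (-(d : ℝ) / 2)) * (2 * A) := by gcongr
        _ = (C₁ * 2) * (A * (r⁻¹ * r ^ (-(d : ℝ) / 2))) := by ring
        _ ≤ C₀ * (A * (r⁻¹ * r ^ (-(d : ℝ) / 2))) := by
          gcongr
          rw [hC₀]
          have : 0 ≤ C₂ * (d + 3) := by positivity
          linarith
        _ = _ := by ring
    have hb2 : ‖∫ x, F x • Complex.exp (((θ x : ℝ) : ℂ) * Complex.I)‖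
        ≤ C₀ * A * (r⁻¹ * r ^ (-(d : ℝ) / 2)) * (δ * r)⁻¹ ^ (d + 1) := by
      refine (h₂ ψ hψ hψs θ hθ0).trans ?_
      have hS : ∑ j ∈ Finset.range (d + 2 + 1), ∫ t, |iteratedDeriv j ψ t|
          ≤ (d + 3) * (A * δ⁻¹ ^ (d + 1)) := by
        refine (Finset.sum_le_card_nsmul _ _ (A * δ⁻¹ ^ (d + 1)) fun j hj => ?_).trans_eq ?_
        · rw [Finset.mem_range] at hj
          refine (hψj j (by omega)).trans ?_
          gcongr
          omega
        · rw [Finset.card_range, nsmul_eq_mul]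
          push_cast; ring
      calc _ ≤ C₂ * (r⁻¹ ^ (d + 2) * r ^ (-(d : ℝ) / 2)) * ((d + 3) * (A * δ⁻¹ ^ (d + 1))) := by
            gcongr
        _ = (C₂ * (d + 3)) * (A * (r⁻¹ * r ^ (-(d : ℝ) / 2)) * (δ * r)⁻¹ ^ (d + 1)) := by
          rw [mul_inv δ r, mul_pow, pow_succ r⁻¹ (d + 1)]; ring
        _ ≤ C₀ * (A * (r⁻¹ * r ^ (-(d : ℝ) / 2)) * (δ * r)⁻¹ ^ (d + 1)) := by
          gcongr
          rw [hC₀]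
          have : 0 ≤ C₁ * 2 := by positivity
          linarith
        _ = _ := by ring
    have hb : ‖∫ x, F x • Complex.exp (((θ x : ℝ) : ℂ) * Complex.I)‖
        ≤ C₀ * A * (r⁻¹ * r ^ (-(d : ℝ) / 2)) * min 1 ((δ * r)⁻¹ ^ (d + 1)) := by
      rw [mul_min_of_nonneg _ _ (by positivity), mul_one]
      exact le_min hb1 hb2
    rw [integral_scaled_mul_exp hR, norm_smul, Real.norm_of_nonneg (by positivity)]
    refine (mul_le_mul_of_nonneg_left hb (by positivity)).trans_eq ?_
    have e1 : R * δ * ‖toReal m‖ = δ * r := by rw [hr]; ring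
    have e2 : δ ^ (1 + (d : ℝ) / 2) * (δ * r) ^ (-(1 + (d : ℝ) / 2))
        = r⁻¹ * r ^ (-(d : ℝ) / 2) := by
      rw [Real.mul_rpow hδ.le hr0.le, ← mul_assoc, ← Real.rpow_add hδ, add_neg_cancel,
        Real.rpow_zero, one_mul, ← Real.rpow_neg_one r, ← Real.rpow_add hr0]
      congr 1; ring
    rw [e1, decayProfile, ← e2]
    ring
  have hcR : Continuous fun x => F (R⁻¹ • x) := hc.comp (continuous_const_smul _)
  have hsR : HasCompactSupport fun x => F (R⁻¹ • x) :=
    hs.comp_homeomorph (Homeomorph.smulOfNeZero R⁻¹ hRi.ne')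
  have key := norm_tsum_sub_integral_le hsR hcR
    (hsum.mul_left (R ^ (d + 1) * C₀ * A * δ ^ (1 + (d : ℝ) / 2)))
    (mul_nonneg (by positivity) (decayProfile_nonneg (by positivity))) hFT
  rw [integral_scaled hR, tsum_mul_left] at key
  have e3 : ∀ k : Fin (d + 1) → ℤ, F (R⁻¹ • toReal k)
      = ψ (R⁻¹ * g (toReal k)) * a (toReal k) := fun k => by
    simp only [hF]
    rw [hg.hom _ hRi, hhom _ hRi]
  simp only [e3] at key
  refine key.trans ?_
  calc _ ≤ R ^ (d + 1) * C₀ * A * δ ^ (1 + (d : ℝ) / 2) * (C₃ * (R * δ)⁻¹ ^ (d + 1)) := by gcongr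
    _ = C₀ * C₃ * A * ((R * R⁻¹) ^ (d + 1) * (δ ^ (1 + (d : ℝ) / 2) * δ⁻¹ ^ (d + 1))) := by
      rw [mul_inv, mul_pow, mul_pow]; ring
    _ = _ := by
      rw [mul_inv_cancel₀ hR.ne', one_pow, one_mul, inv_pow, ← Real.rpow_natCast,
        ← Real.rpow_neg hδ.le, ← Real.rpow_add hδ]
      congr 2; push_cast; ring

end SmoothedCount

section Cutoff

theorem integrable_iteratedDeriv_smoothTransition {j : ℕ} (hj : j ≠ 0) :
    Integrable (iteratedDeriv j Real.smoothTransition) := by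
  have hc : Continuous (iteratedDeriv j Real.smoothTransition) :=
    (Real.smoothTransition.contDiff (n := ⊤)).continuous_iteratedDeriv j (by exact_mod_cast le_top)
  refine hc.integrable_of_hasCompactSupport
    (HasCompactSupport.of_support_subset_isCompact (isCompact_Icc (a := 0) (b := 1)) ?_)
  intro x hx
  by_contra h
  refine hx ?_
  rcases not_and_or.1 h with h | h
  · have : Real.smoothTransition =ᶠ[𝓝 x] fun _ => 0 := by
      filter_upwards [gt_mem_nhds (not_le.1 h)] with y hy
      exact Real.smoothTransition.zero_of_nonpos hy.le
    rw [this.iteratedDeriv_eq, iteratedDeriv_const, if_neg hj]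
  · have : Real.smoothTransition =ᶠ[𝓝 x] fun _ => 1 := by
      filter_upwards [lt_mem_nhds (not_le.1 h)] with y hy
      exact Real.smoothTransition.one_of_one_le hy.le
    rw [this.iteratedDeriv_eq, iteratedDeriv_const, if_neg hj]

theorem integral_iteratedDeriv_step {j : ℕ} (hj : j ≠ 0) {δ : ℝ} (hδ : 0 < δ) (c : ℝ) :
    Integrable (iteratedDeriv j fun t => Real.smoothTransition (δ⁻¹ * (t - c))) ∧
    ∫ t, |iteratedDeriv j (fun t => Real.smoothTransition (δ⁻¹ * (t - c))) t|
      = δ⁻¹ ^ (j - 1) * ∫ t, |iteratedDeriv j Real.smoothTransition t| := by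
  have h1 : iteratedDeriv j (fun t => Real.smoothTransition (δ⁻¹ * (t - c)))
      = fun t => δ⁻¹ ^ j * iteratedDeriv j Real.smoothTransition (δ⁻¹ * (t - c)) := by
    rw [iteratedDeriv_comp_sub_const j (fun z => Real.smoothTransition (δ⁻¹ * z)) c,
      iteratedDeriv_comp_const_mul Real.smoothTransition.contDiff]
  have hδi : 0 < δ⁻¹ := inv_pos.2 hδ
  constructor
  · rw [h1]
    exact (((integrable_iteratedDeriv_smoothTransition hj).comp_mul_left' hδi.ne').comp_sub_right
      c).const_mul _
  · simp only [h1, abs_mul, abs_of_pos (pow_pos hδi j)]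
    rw [integral_const_mul, integral_sub_right_eq_self
      (fun t => |iteratedDeriv j Real.smoothTransition (δ⁻¹ * t)|),
      integral_comp_inv_mul_left (fun t => |iteratedDeriv j Real.smoothTransition t|),
      abs_of_pos hδ, smul_eq_mul, ← mul_assoc]
    congr 1
    obtain ⟨i, rfl⟩ := Nat.exists_eq_succ_of_ne_zero hj
    rw [pow_succ, mul_assoc, inv_mul_cancel₀ hδ.ne', mul_one]
    simp

theorem exists_cutoff (N : ℕ) : ∃ A : ℝ, 0 ≤ A ∧ ∀ a b δ : ℝ, 0 < δ → a + δ ≤ b → 1 / 4 ≤ a →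
    b + δ ≤ 2 → ∃ ψ : ℝ → ℝ, ContDiff ℝ ∞ ψ ∧ Function.support ψ ⊆ Icc (1 / 4) 2 ∧
      (∀ t, 0 ≤ ψ t) ∧ (∀ t, ψ t ≤ 1) ∧ (∀ t, a + δ ≤ t → t ≤ b → ψ t = 1) ∧
      (∀ t, t ≤ a → ψ t = 0) ∧ (∀ t, b + δ ≤ t → ψ t = 0) ∧
      ∀ j ≤ N, ∫ t, |iteratedDeriv j ψ t| ≤ A * δ⁻¹ ^ (j - 1) := by
  refine ⟨2 + ∑ j ∈ Finset.range (N + 1), 2 * ∫ t, |iteratedDeriv j Real.smoothTransition t|,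
    add_nonneg zero_le_two (Finset.sum_nonneg fun j _ => ?_), ?_⟩
  · exact mul_nonneg zero_le_two (integral_nonneg fun t => abs_nonneg _)
  intro a b δ hδ hab ha hb
  have hδi : 0 < δ⁻¹ := inv_pos.2 hδ
  have hstep0 : ∀ c t : ℝ, t ≤ c → Real.smoothTransition (δ⁻¹ * (t - c)) = 0 := fun c t h =>
    Real.smoothTransition.zero_of_nonpos (mul_nonpos_of_nonneg_of_nonpos hδi.le (by linarith))
  have hstep1 : ∀ c t : ℝ, c + δ ≤ t → Real.smoothTransition (δ⁻¹ * (t - c)) = 1 := fun c t h =>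
    Real.smoothTransition.one_of_one_le (by
      rw [← inv_mul_cancel₀ hδ.ne']
      exact mul_le_mul_of_nonneg_left (by linarith) hδi.le)
  have hsm : ∀ (c : ℝ), ContDiff ℝ ∞ fun t => Real.smoothTransition (δ⁻¹ * (t - c)) := fun c =>
    Real.smoothTransition.contDiff.comp (contDiff_const.mul (contDiff_id.sub contDiff_const))
  set ψ : ℝ → ℝ := fun t => Real.smoothTransition (δ⁻¹ * (t - a))
    - Real.smoothTransition (δ⁻¹ * (t - b)) with hψ
  have hlow : ∀ t, t ≤ a → ψ t = 0 := fun t ht => by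
    simp only [hψ]
    rw [hstep0 a t ht, hstep0 b t (by linarith), sub_zero]
  have hhigh : ∀ t, b + δ ≤ t → ψ t = 0 := fun t ht => by
    simp only [hψ]
    rw [hstep1 a t (by linarith), hstep1 b t ht, sub_self]
  have hnn : ∀ t, 0 ≤ ψ t := fun t => by
    simp only [hψ]
    rcases le_total t b with h | h
    · rw [hstep0 b t h, sub_zero]; exact Real.smoothTransition.nonneg _
    · rw [hstep1 a t (by linarith), sub_nonneg]; exact Real.smoothTransition.le_one _
  have hle1 : ∀ t, ψ t ≤ 1 := fun t => by
    have h1 := Real.smoothTransition.nonneg (δ⁻¹ * (t - b))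
    have h2 := Real.smoothTransition.le_one (δ⁻¹ * (t - a))
    simp only [hψ]; linarith
  have hsupp : Function.support ψ ⊆ Icc (1 / 4) 2 := fun t ht => by
    constructor
    · by_contra h
      exact ht (hlow t (by linarith))
    · by_contra h
      exact ht (hhigh t (by linarith))
  refine ⟨ψ, (hsm a).sub (hsm b), hsupp, hnn, hle1, fun t h1 h2 => ?_, hlow, hhigh,
    fun j hj => ?_⟩
  · simp only [hψ]
    rw [hstep1 a t h1, hstep0 b t h2, sub_zero]
  have hsum0 : ∀ j ∈ Finset.range (N + 1),
      0 ≤ 2 * ∫ t, |iteratedDeriv j Real.smoothTransition t| := fun j _ =>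
    mul_nonneg zero_le_two (integral_nonneg fun t => abs_nonneg _)
  rcases eq_or_ne j 0 with rfl | hj0
  · simp only [iteratedDeriv_zero, Nat.zero_sub, pow_zero, mul_one]
    refine le_trans ?_ (le_add_of_nonneg_right (Finset.sum_nonneg hsum0))
    have h1 : ∫ t, |ψ t| = ∫ t in Icc (1 / 4) 2, |ψ t| := by
      refine (setIntegral_eq_integral_of_forall_compl_eq_zero fun t ht => ?_).symm
      rw [Function.notMem_support.1 fun h => ht (hsupp h), abs_zero]
    rw [h1]
    have h2 := norm_setIntegral_le_of_norm_le_const (μ := volume) (s := Icc (1 / 4 : ℝ) 2)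
      (f := fun t => |ψ t|) (C := 1) (by simp) (fun t _ => by
        rw [Real.norm_eq_abs, abs_abs, abs_of_nonneg (hnn t)]; exact hle1 t)
    refine (le_abs_self _).trans (h2.trans ?_)
    rw [measureReal_def, Real.volume_Icc, ENNReal.toReal_ofReal (by norm_num)]
    norm_num
  · obtain ⟨ia, ea⟩ := integral_iteratedDeriv_step hj0 hδ a
    obtain ⟨ib, eb⟩ := integral_iteratedDeriv_step hj0 hδ b
    have h1 : ∀ t, iteratedDeriv j ψ t
        = iteratedDeriv j (fun t => Real.smoothTransition (δ⁻¹ * (t - a))) t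
          - iteratedDeriv j (fun t => Real.smoothTransition (δ⁻¹ * (t - b))) t := fun t =>
      iteratedDeriv_fun_sub ((hsm a).of_le (by exact_mod_cast le_top)).contDiffAt
        ((hsm b).of_le (by exact_mod_cast le_top)).contDiffAt
    calc ∫ t, |iteratedDeriv j ψ t|
        ≤ ∫ t, (|iteratedDeriv j (fun t => Real.smoothTransition (δ⁻¹ * (t - a))) t|
          + |iteratedDeriv j (fun t => Real.smoothTransition (δ⁻¹ * (t - b))) t|) := by
          refine integral_mono_of_nonneg (ae_of_all _ fun t => abs_nonneg _) (ia.abs.add ib.abs)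
            (ae_of_all _ fun t => ?_)
          simp only [h1]
          exact abs_sub _ _
      _ = (2 * ∫ t, |iteratedDeriv j Real.smoothTransition t|) * δ⁻¹ ^ (j - 1) := by
        rw [integral_add ia.abs ib.abs, ea, eb]; ring
      _ ≤ _ := by
        gcongr
        have := Finset.single_le_sum hsum0 (Finset.mem_range.2 (by omega : j < N + 1))
        linarith

end Cutoff

section Counting

variable {n : ℕ} {g f : (Fin n → ℝ) → ℝ}

/-- The weighted number of nonzero lattice points in the sublevel set `{g < R}`. -/
noncomputable def latticeSum (g f : (Fin n → ℝ) → ℝ) (R : ℝ) : ℝ :=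
  ∑' k : Fin n → ℤ, {k : Fin n → ℤ | k ≠ 0 ∧ g (toReal k) < R}.indicator (fun k => f (toReal k)) k

theorem IsGauge.finite_toReal_le (hg : IsGauge g) (R : ℝ) :
    {k : Fin n → ℤ | g (toReal k) ≤ R}.Finite := by
  obtain ⟨m, hm, hmg⟩ := hg.exists_lower
  refine (finite_norm_toReal_le (R / m)).subset fun k hk => ?_
  rw [mem_ofPred_eq, le_div_iff₀ hm, mul_comm]
  exact (hmg _).trans hk

theorem IsGauge.summable_indicator (hg : IsGauge g) (f : (Fin n → ℝ) → ℝ) (R : ℝ) :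
    Summable ({k : Fin n → ℤ | k ≠ 0 ∧ g (toReal k) < R}.indicator fun k => f (toReal k)) := by
  refine summable_of_hasFiniteSupport ((hg.finite_toReal_le R).subset fun k hk => ?_)
  exact (mem_of_indicator_ne_zero hk).2.le

theorem exists_bound_of_homogeneous (hf : ContinuousOn f {0}ᶜ)
    (hhom : ∀ t : ℝ, 0 < t → ∀ x, f (t • x) = f x) : ∃ B : ℝ, 0 ≤ B ∧ ∀ x ≠ 0, |f x| ≤ B := by
  obtain ⟨B, hB⟩ := (isCompact_sphere (0 : Fin n → ℝ) 1).exists_bound_of_continuousOn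
    (hf.mono fun x hx => by rintro rfl; simp at hx)
  refine ⟨|B|, abs_nonneg _, fun x hx => ?_⟩
  have hx' : 0 < ‖x‖ := norm_pos_iff.2 hx
  rw [← hhom ‖x‖⁻¹ (inv_pos.2 hx') x]
  exact (hB _ (by simp [norm_smul, hx'.ne'])).trans (le_abs_self B)

theorem aestronglyMeasurable_of_continuousOn_compl [NeZero n] (hf : ContinuousOn f {0}ᶜ) :
    AEStronglyMeasurable f volume := by
  have h := hf.aestronglyMeasurable (μ := volume) (measurableSet_singleton _).compl
  rwa [restrict_eq_self_of_ae_mem] at h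
  exact compl_mem_ae_iff.2 (measure_singleton (0 : Fin n → ℝ))

theorem IsGauge.measurableSet_lt (hg : IsGauge g) (R : ℝ) : MeasurableSet {x | g x < R} :=
  (isOpen_lt hg.cont continuous_const).measurableSet

theorem IsGauge.integrableOn_lt [NeZero n] (hg : IsGauge g) (hf : ContinuousOn f {0}ᶜ)
    (hhom : ∀ t : ℝ, 0 < t → ∀ x, f (t • x) = f x) (R : ℝ) :
    IntegrableOn f {x | g x < R} := by
  obtain ⟨B, -, hB⟩ := exists_bound_of_homogeneous hf hhom
  refine Measure.integrableOn_of_bounded (M := B) ?_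
    (aestronglyMeasurable_of_continuousOn_compl hf) (ae_restrict_of_ae ?_)
  · exact ((measure_mono fun x (hx : g x < R) => hx.le).trans_lt
      (hg.isCompact_sublevel R).measure_lt_top).ne
  · filter_upwards [compl_mem_ae_iff.2 (measure_singleton (0 : Fin n → ℝ))] with x hx
    exact hB x hx

theorem IsGauge.integral_lt (hg : IsGauge g)
    (hhom : ∀ t : ℝ, 0 < t → ∀ x, f (t • x) = f x) {R : ℝ} (hR : 0 < R) :
    ∫ x in {x | g x < R}, f x = R ^ n * ∫ x in {x | g x < 1}, f x := by
  rw [← integral_indicator (hg.measurableSet_lt R), ← integral_indicator (hg.measurableSet_lt 1),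
    ← integral_scaled hR]
  refine integral_congr_ae (ae_of_all _ fun x => ?_)
  have hRi := inv_pos.2 hR
  simp only [indicator, mem_ofPred_eq, hg.hom _ hRi, hhom _ hRi, inv_mul_lt_iff₀ hR, mul_one]

theorem IsGauge.integral_annulus [NeZero n] (hg : IsGauge g) (hf : ContinuousOn f {0}ᶜ)
    (hhom : ∀ t : ℝ, 0 < t → ∀ x, f (t • x) = f x) {s t : ℝ} (hs : 0 < s) (ht : 0 < t) :
    Integrable (fun x => {x | g x < t}.indicator f x - {x | g x < s}.indicator f x) ∧
    ∫ x, ({x | g x < t}.indicator f x - {x | g x < s}.indicator f x)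
      = (t ^ n - s ^ n) * ∫ x in {x | g x < 1}, f x := by
  have hi : ∀ r, Integrable ({x | g x < r}.indicator f) := fun r =>
    (hg.integrableOn_lt hf hhom r).integrable_indicator (hg.measurableSet_lt r)
  refine ⟨(hi t).sub (hi s), ?_⟩
  rw [integral_sub (hi t) (hi s), integral_indicator (hg.measurableSet_lt _),
    integral_indicator (hg.measurableSet_lt _), hg.integral_lt hhom hs, hg.integral_lt hhom ht]
  ring

theorem latticeSum_sub (hg : IsGauge g) (f : (Fin n → ℝ) → ℝ) (s t : ℝ) :
    HasSum (fun k : Fin n → ℤ =>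
      {k : Fin n → ℤ | k ≠ 0 ∧ g (toReal k) < t}.indicator (fun k => f (toReal k)) k
      - {k : Fin n → ℤ | k ≠ 0 ∧ g (toReal k) < s}.indicator (fun k => f (toReal k)) k)
      (latticeSum g f t - latticeSum g f s) :=
  (hg.summable_indicator f t).hasSum.sub (hg.summable_indicator f s).hasSum

theorem abs_pow_sub_pow_le_of_le_two {s t : ℝ} (hs : 0 ≤ s) (ht : 0 ≤ t) (hs2 : s ≤ 2)
    (ht2 : t ≤ 2) (n : ℕ) : |t ^ n - s ^ n| ≤ n * 2 ^ (n - 1) * |t - s| := by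
  refine (abs_pow_sub_pow_le t s n).trans ?_
  rw [abs_of_nonneg hs, abs_of_nonneg ht, mul_assoc, mul_comm |t - s|]
  gcongr
  exact max_le ht2 hs2

theorem IsGauge.dyadic_count {d : ℕ} (hd : 1 ≤ d) {g f : (Fin (d + 1) → ℝ) → ℝ} (hg : IsGauge g)
    (hf : ContDiffOn ℝ ∞ f {0}ᶜ) (hhom : ∀ t : ℝ, 0 < t → ∀ x, f (t • x) = f x)
    (hf0 : ∀ x ≠ 0, 0 ≤ f x) :
    ∃ C : ℝ, 0 ≤ C ∧ ∀ R δ : ℝ, 0 < R → 0 < δ → δ ≤ 1 / 8 →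
      |latticeSum g f R - latticeSum g f (R / 2)
        - R ^ (d + 1) * ((1 - (1 / 2) ^ (d + 1)) * ∫ x in {x | g x < 1}, f x)|
        ≤ C * (R ^ (d + 1) * δ + δ ^ (-(d : ℝ) / 2)) := by
  obtain ⟨A, hA, hcut⟩ := exists_cutoff (d + 2)
  obtain ⟨C, hC, hcount⟩ := hg.smoothed_count hd hf hhom
  set I := ∫ x in {x | g x < 1}, f x with hI
  have hae : ∀ᵐ x : Fin (d + 1) → ℝ, x ≠ 0 :=
    compl_mem_ae_iff.2 (measure_singleton (0 : Fin (d + 1) → ℝ))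
  have hI0 : 0 ≤ I := integral_nonneg_of_ae (ae_restrict_of_ae (hae.mono fun x hx => hf0 x hx))
  set K : ℝ := 2 * ((d + 1 : ℕ) * 2 ^ (d + 1 - 1)) with hK
  have hK0 : 0 ≤ K := by positivity
  have hpow : ∀ (δ s t s' t' : ℝ), 0 ≤ s → s ≤ 2 → 0 ≤ t → t ≤ 2 → 0 ≤ s' → s' ≤ 2 → 0 ≤ t' →
      t' ≤ 2 → |t - t'| ≤ δ → |s' - s| ≤ δ →
      (t ^ (d + 1) - s ^ (d + 1)) - (t' ^ (d + 1) - s' ^ (d + 1)) ≤ K * δ := by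
    intro δ s t s' t' hs hs2 ht ht2 hs' hs2' ht' ht2' h1 h2
    have e1 := (le_abs_self _).trans (abs_pow_sub_pow_le_of_le_two ht' ht ht2' ht2 (d + 1))
    have e2 := (le_abs_self _).trans (abs_pow_sub_pow_le_of_le_two hs hs' hs2 hs2' (d + 1))
    have e3 : ((d + 1 : ℕ) * 2 ^ (d + 1 - 1) : ℝ) * |t - t'| ≤ ((d + 1 : ℕ) * 2 ^ (d + 1 - 1)) * δ :=
      mul_le_mul_of_nonneg_left h1 (by positivity)
    have e4 : ((d + 1 : ℕ) * 2 ^ (d + 1 - 1) : ℝ) * |s' - s| ≤ ((d + 1 : ℕ) * 2 ^ (d + 1 - 1)) * δ :=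
      mul_le_mul_of_nonneg_left h2 (by positivity)
    rw [hK]
    linarith
  refine ⟨K * I + C * A, by positivity, fun R δ hR hδ hδ8 => ?_⟩
  have hRi := inv_pos.2 hR
  have hne : ∀ k : Fin (d + 1) → ℤ, k ≠ 0 → toReal k ≠ 0 := fun k hk h => hk (toReal_eq_zero.1 h)
  have hsumψ : ∀ ψ : ℝ → ℝ, Function.support ψ ⊆ Icc (1 / 4) 2 →
      Summable fun k : Fin (d + 1) → ℤ => ψ (R⁻¹ * g (toReal k)) * f (toReal k) := by
    intro ψ hψ
    refine summable_of_hasFiniteSupport ((hg.finite_toReal_le (R * 2)).subset fun k hk => ?_)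
    have := (hψ (left_ne_zero_of_mul hk)).2
    rwa [inv_mul_le_iff₀ hR] at this
  have hintψ : ∀ ψ : ℝ → ℝ, ContDiff ℝ ∞ ψ → Function.support ψ ⊆ Icc (1 / 4) 2 →
      Integrable fun x => ψ (g x) * f x := by
    intro ψ hψ hψs
    obtain ⟨h1, h2⟩ := hg.continuous_annulus hf.continuousOn hψ.continuous hψs
    exact h1.integrable_of_hasCompactSupport h2
  have hpos : 0 ≤ C * A := by positivity
  have hRn : 0 < R ^ (d + 1) := by positivity
  have hδp : 0 ≤ δ ^ (-(d : ℝ) / 2) := by positivity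
  have hx1 : 0 ≤ K * I * δ ^ (-(d : ℝ) / 2) := by positivity
  have hx2 : 0 ≤ C * A * (R ^ (d + 1) * δ) := by positivity
  rw [abs_le]
  constructor
  · obtain ⟨ψ, hψ, hψs, hψ0, hψ1, hψe, hψl, hψr, hψj⟩ :=
      hcut (1 / 2) (1 - δ) δ hδ (by linarith) (by norm_num) (by linarith)
    have hmain := (abs_le.1 (hcount A δ R ψ hA hδ (by linarith) hR hψ hψs hψj)).1
    have hS : ∑' k : Fin (d + 1) → ℤ, ψ (R⁻¹ * g (toReal k)) * f (toReal k)
        ≤ latticeSum g f R - latticeSum g f (R / 2) := by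
      rw [← (latticeSum_sub hg f (R / 2) R).tsum_eq]
      refine (hsumψ ψ hψs).tsum_le_tsum (fun k => ?_) (latticeSum_sub hg f (R / 2) R).summable
      rcases eq_or_ne k 0 with rfl | hk
      · rw [toReal_eq_zero.2 rfl, hg.map_zero, mul_zero, hψl 0 (by norm_num)]
        simp
      have hfk := hf0 _ (hne k hk)
      simp only [indicator, mem_ofPred_eq, hk, ne_eq, not_false_eq_true, true_and]
      by_cases h1 : g (toReal k) < R / 2
      · rw [if_pos h1, if_pos (by linarith), hψl _ (by rw [inv_mul_le_iff₀ hR]; linarith)]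
        simp
      · rw [if_neg h1]
        by_cases h2 : g (toReal k) < R
        · rw [if_pos h2, sub_zero]
          exact mul_le_of_le_one_left hfk (hψ1 _)
        · rw [if_neg h2, hψr _ (by rw [le_inv_mul_iff₀ hR]; linarith)]
          simp
    have hInt : ((1 - δ) ^ (d + 1) - (1 / 2 + δ) ^ (d + 1)) * I ≤ ∫ x, ψ (g x) * f x := by
      obtain ⟨h1, h2⟩ := hg.integral_annulus hf.continuousOn hhom
        (s := 1 / 2 + δ) (t := 1 - δ) (by linarith) (by linarith)
      rw [← h2]
      refine integral_mono_ae h1 (hintψ ψ hψ hψs) (hae.mono fun x hx => ?_)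
      have hfx := hf0 x hx
      simp only [indicator, mem_ofPred_eq]
      by_cases h3 : g x < 1 / 2 + δ
      · rw [if_pos h3, if_pos (by linarith), sub_self]
        exact mul_nonneg (hψ0 _) hfx
      · rw [if_neg h3, sub_zero]
        by_cases h4 : g x < 1 - δ
        · rw [if_pos h4, hψe _ (by linarith) h4.le, one_mul]
        · rw [if_neg h4]
          exact mul_nonneg (hψ0 _) hfx
    have hp := hpow δ (1 / 2) 1 (1 / 2 + δ) (1 - δ) (by norm_num) (by norm_num) (by norm_num)
      (by norm_num) (by linarith) (by linarith) (by linarith) (by linarith)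
      (by rw [abs_of_nonneg] <;> linarith) (by rw [abs_of_nonneg] <;> linarith)
    rw [one_pow] at hp
    have hp2 := mul_le_mul_of_nonneg_left (mul_le_mul_of_nonneg_right hp hI0) hRn.le
    have hInt2 := mul_le_mul_of_nonneg_left hInt hRn.le
    nlinarith
  · obtain ⟨ψ, hψ, hψs, hψ0, hψ1, hψe, hψl, hψr, hψj⟩ :=
      hcut (1 / 2 - δ) 1 δ hδ (by linarith) (by linarith) (by linarith)
    have hmain := (abs_le.1 (hcount A δ R ψ hA hδ (by linarith) hR hψ hψs hψj)).2
    have hS : latticeSum g f R - latticeSum g f (R / 2)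
        ≤ ∑' k : Fin (d + 1) → ℤ, ψ (R⁻¹ * g (toReal k)) * f (toReal k) := by
      rw [← (latticeSum_sub hg f (R / 2) R).tsum_eq]
      refine (latticeSum_sub hg f (R / 2) R).summable.tsum_le_tsum (fun k => ?_) (hsumψ ψ hψs)
      rcases eq_or_ne k 0 with rfl | hk
      · rw [toReal_eq_zero.2 rfl, hg.map_zero, mul_zero, hψl 0 (by linarith)]
        simp
      have hfk := hf0 _ (hne k hk)
      have hψk := mul_nonneg (hψ0 (R⁻¹ * g (toReal k))) hfk
      simp only [indicator, mem_ofPred_eq, hk, ne_eq, not_false_eq_true, true_and]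
      by_cases h1 : g (toReal k) < R / 2
      · rwa [if_pos h1, if_pos (by linarith), sub_self]
      · rw [if_neg h1, sub_zero]
        by_cases h2 : g (toReal k) < R
        · rw [if_pos h2, hψe _ (by rw [le_inv_mul_iff₀ hR]; linarith)
            (by rw [inv_mul_le_iff₀ hR]; linarith), one_mul]
        · rwa [if_neg h2]
    have hInt : ∫ x, ψ (g x) * f x ≤ ((1 + δ) ^ (d + 1) - (1 / 2 - δ) ^ (d + 1)) * I := by
      obtain ⟨h1, h2⟩ := hg.integral_annulus hf.continuousOn hhom
        (s := 1 / 2 - δ) (t := 1 + δ) (by linarith) (by linarith)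
      rw [← h2]
      refine integral_mono_ae (hintψ ψ hψ hψs) h1 (hae.mono fun x hx => ?_)
      have hfx := hf0 x hx
      simp only [indicator, mem_ofPred_eq]
      by_cases h3 : g x < 1 / 2 - δ
      · rw [if_pos h3, if_pos (by linarith), sub_self, hψl _ h3.le, zero_mul]
      · rw [if_neg h3, sub_zero]
        by_cases h4 : g x < 1 + δ
        · rw [if_pos h4]
          exact mul_le_of_le_one_left hfx (hψ1 _)
        · rw [if_neg h4, hψr _ (not_lt.1 h4), zero_mul]
    have hp := hpow δ (1 / 2 - δ) (1 + δ) (1 / 2) 1 (by linarith) (by linarith) (by linarith)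
      (by linarith) (by norm_num) (by norm_num) (by norm_num) (by norm_num)
      (by rw [abs_of_nonneg] <;> linarith) (by rw [abs_of_nonneg] <;> linarith)
    rw [one_pow] at hp
    have hp2 := mul_le_mul_of_nonneg_left (mul_le_mul_of_nonneg_right hp hI0) hRn.le
    have hInt2 := mul_le_mul_of_nonneg_left hInt hRn.le
    nlinarith

end Counting

section DyadicSummation

theorem exists_bound_of_dyadic {G : ℝ → ℝ} {α B C : ℝ} (hα : 0 < α) (hB : 0 ≤ B) (hC : 0 ≤ C)
    (h0 : ∀ R, 0 < R → R ≤ 1 → |G R| ≤ B) (h1 : ∀ R, 1 ≤ R → |G R - G (R / 2)| ≤ C * R ^ α) :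
    ∃ K : ℝ, 0 ≤ K ∧ ∀ R, 1 ≤ R → |G R| ≤ K * R ^ α := by
  have hβ1 : (2 : ℝ)⁻¹ ^ α < 1 := Real.rpow_lt_one (by norm_num) (by norm_num) hα
  set β : ℝ := (2 : ℝ)⁻¹ ^ α with hβ
  set D : ℝ := C / (1 - β) with hD
  have hD0 : 0 ≤ D := div_nonneg hC (by linarith)
  have hDC : D * β + C = D := by
    rw [hD]
    have : 1 - β ≠ 0 := by linarith
    field_simp
    ring
  have key : ∀ j : ℕ, ∀ R, 0 < R → R ≤ 2 ^ j → |G R| ≤ B + D * R ^ α := by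
    intro j
    induction j with
    | zero =>
      intro R hR hR1
      exact (h0 R hR (by simpa using hR1)).trans (le_add_of_nonneg_right (by positivity))
    | succ j ih =>
      intro R hR hRj
      rcases le_total R 1 with h | h
      · exact (h0 R hR h).trans (le_add_of_nonneg_right (by positivity))
      · have e1 := ih (R / 2) (by positivity) (by rw [pow_succ] at hRj; linarith)
        have e2 := h1 R h
        have e3 : (R / 2) ^ α = R ^ α * β := by
          rw [div_eq_mul_inv, Real.mul_rpow hR.le (by norm_num)]
        rw [e3] at e1
        have e4 : |G R| ≤ |G R - G (R / 2)| + |G (R / 2)| := by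
          have := abs_add_le (G R - G (R / 2)) (G (R / 2))
          rwa [sub_add_cancel] at this
        calc |G R| ≤ C * R ^ α + (B + D * (R ^ α * β)) := by linarith
          _ = B + (D * β + C) * R ^ α := by ring
          _ = _ := by rw [hDC]
  refine ⟨B + D, by positivity, fun R hR => ?_⟩
  obtain ⟨j, hj⟩ := pow_unbounded_of_one_lt R (one_lt_two (α := ℝ))
  refine (key j R (by linarith) hj.le).trans ?_
  have : 1 ≤ R ^ α := Real.one_le_rpow hR hα.le
  nlinarith

end DyadicSummation

section Asymptotics

variable {d : ℕ} {g f : (Fin (d + 1) → ℝ) → ℝ}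

theorem IsGauge.latticeSum_asymptotics_of_nonneg (hd : 1 ≤ d) (hg : IsGauge g)
    (hf : ContDiffOn ℝ ∞ f {0}ᶜ) (hhom : ∀ t : ℝ, 0 < t → ∀ x, f (t • x) = f x)
    (hf0 : ∀ x ≠ 0, 0 ≤ f x) :
    ∃ K : ℝ, 0 ≤ K ∧ ∀ R : ℝ, 1 ≤ R →
      |latticeSum g f R - R ^ (d + 1) * ∫ x in {x | g x < 1}, f x|
        ≤ K * R ^ ((d : ℝ) + 1 - 2 * (d + 1) / (d + 2)) := by
  obtain ⟨C, hC, hdy⟩ := hg.dyadic_count hd hf hhom hf0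
  set I := ∫ x in {x | g x < 1}, f x with hI
  have hae : ∀ᵐ x : Fin (d + 1) → ℝ, x ≠ 0 :=
    compl_mem_ae_iff.2 (measure_singleton (0 : Fin (d + 1) → ℝ))
  have hI0 : 0 ≤ I := integral_nonneg_of_ae (ae_restrict_of_ae (hae.mono fun x hx => hf0 x hx))
  have hne : ∀ k : Fin (d + 1) → ℤ, k ≠ 0 → toReal k ≠ 0 := fun k hk h => hk (toReal_eq_zero.1 h)
  have hd' : (1 : ℝ) ≤ d := by exact_mod_cast hd
  have hα : (d : ℝ) + 1 - 2 * (d + 1) / (d + 2) = d * (d + 1) / (d + 2) := by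
    field_simp; ring
  have hα0 : 0 < (d : ℝ) + 1 - 2 * (d + 1) / (d + 2) := by rw [hα]; positivity
  have hind : ∀ (R : ℝ) (k : Fin (d + 1) → ℤ), 0 ≤ {k : Fin (d + 1) → ℤ |
      k ≠ 0 ∧ g (toReal k) < R}.indicator (fun k => f (toReal k)) k := fun R =>
    indicator_nonneg fun k hk => hf0 _ (hne k hk.1)
  have hS0 : ∀ R, 0 ≤ latticeSum g f R := fun R => tsum_nonneg (hind R)
  have hmono : ∀ R, R ≤ 1 → latticeSum g f R ≤ latticeSum g f 1 := fun R hR => by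
    refine (hg.summable_indicator f R).tsum_le_tsum (fun k => ?_) (hg.summable_indicator f 1)
    have h1 := hind 1 k
    simp only [indicator, mem_ofPred_eq] at h1 ⊢
    by_cases hk : k ≠ 0 ∧ g (toReal k) < R
    · rw [if_pos hk, if_pos ⟨hk.1, hk.2.trans_le hR⟩]
    · rwa [if_neg hk]
  refine exists_bound_of_dyadic (G := fun R => latticeSum g f R - R ^ (d + 1) * I)
    (B := latticeSum g f 1 + I) (C := C * (1 + (8 : ℝ) ^ ((d : ℝ) / 2))) hα0
    (add_nonneg (hS0 1) hI0) (by positivity) (fun R hR hR1 => ?_) (fun R hR => ?_)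
  · have e1 : R ^ (d + 1) * I ≤ I := mul_le_of_le_one_left hI0 (pow_le_one₀ hR.le hR1)
    have e2 : 0 ≤ R ^ (d + 1) * I := by positivity
    have e3 := hmono R hR1
    have e4 := hS0 R
    have e5 := hS0 1
    rw [abs_le]
    constructor <;> linarith
  · have hR0 : 0 < R := by linarith
    set δ : ℝ := 8⁻¹ * R ^ (-(2 * ((d : ℝ) + 1) / (d + 2))) with hδ
    have hδ0 : 0 < δ := by positivity
    have hδ8 : δ ≤ 1 / 8 := by
      have : R ^ (-(2 * ((d : ℝ) + 1) / (d + 2))) ≤ 1 :=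
        Real.rpow_le_one_of_one_le_of_nonpos hR (neg_nonpos.2 (by positivity))
      rw [hδ]; linarith
    have e1 : R ^ (d + 1) * δ ≤ R ^ ((d : ℝ) + 1 - 2 * (d + 1) / (d + 2)) := by
      have : R ^ (d + 1) * δ = 8⁻¹ * R ^ ((d : ℝ) + 1 - 2 * (d + 1) / (d + 2)) := by
        rw [hδ, sub_eq_add_neg, Real.rpow_add hR0, ← Real.rpow_natCast R (d + 1)]
        push_cast; ring
      rw [this]
      exact mul_le_of_le_one_left (by positivity) (by norm_num)
    have e2 : δ ^ (-(d : ℝ) / 2)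
        = 8 ^ ((d : ℝ) / 2) * R ^ ((d : ℝ) + 1 - 2 * (d + 1) / (d + 2)) := by
      rw [hα, hδ, Real.mul_rpow (by norm_num) (by positivity), ← Real.rpow_mul hR0.le,
        Real.inv_rpow (by norm_num), ← Real.rpow_neg (by norm_num)]
      congr 2 <;> ring
    have h := hdy R δ hR0 hδ0 hδ8
    have e3 : latticeSum g f R - R ^ (d + 1) * I - (latticeSum g f (R / 2)
          - (R / 2) ^ (d + 1) * I)
        = latticeSum g f R - latticeSum g f (R / 2)
          - R ^ (d + 1) * ((1 - (1 / 2) ^ (d + 1)) * I) := by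
      rw [div_eq_mul_one_div R 2, mul_pow]; ring
    simp only [e3]
    refine h.trans ?_
    rw [e2, mul_assoc]
    refine mul_le_mul_of_nonneg_left ?_ hC
    rw [add_mul, one_mul]
    exact add_le_add_left e1 _

theorem IsGauge.latticeSum_asymptotics (hd : 1 ≤ d) (hg : IsGauge g)
    (hf : ContDiffOn ℝ ∞ f {0}ᶜ) (hhom : ∀ t : ℝ, 0 < t → ∀ x, f (t • x) = f x) :
    ∃ K : ℝ, 0 ≤ K ∧ ∀ R : ℝ, 1 ≤ R →
      |latticeSum g f R - R ^ (d + 1) * ∫ x in {x | g x < 1}, f x|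
        ≤ K * R ^ ((d : ℝ) + 1 - 2 * (d + 1) / (d + 2)) := by
  obtain ⟨B, hB, hfB⟩ := exists_bound_of_homogeneous hf.continuousOn hhom
  obtain ⟨K₁, hK₁, h₁⟩ := hg.latticeSum_asymptotics_of_nonneg hd (f := fun x => f x + B)
    (hf.add contDiffOn_const) (fun t ht x => by rw [hhom t ht x])
    (fun x hx => by linarith [(abs_le.1 (hfB x hx)).1])
  obtain ⟨K₂, hK₂, h₂⟩ := hg.latticeSum_asymptotics_of_nonneg hd (f := fun _ => B)
    contDiffOn_const (fun _ _ _ => rfl) (fun _ _ => hB)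
  refine ⟨K₁ + K₂, by positivity, fun R hR => ?_⟩
  have e1 : ∫ x in {x | g x < 1}, (f x + B)
      = (∫ x in {x | g x < 1}, f x) + ∫ x in {x | g x < 1}, B :=
    integral_add (hg.integrableOn_lt hf.continuousOn hhom 1)
      (hg.integrableOn_lt (f := fun _ => B) continuousOn_const (fun _ _ _ => rfl) 1)
  have e2 : latticeSum g (fun x => f x + B) R
      = latticeSum g f R + latticeSum g (fun _ => B) R := by
    unfold latticeSum
    rw [← (hg.summable_indicator f R).tsum_add (hg.summable_indicator (fun _ => B) R)]
    refine tsum_congr fun k => ?_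
    exact indicator_add' _ (fun k => f (toReal k)) (fun _ => B) ▸ rfl
  have a1 := h₁ R hR
  have a2 := h₂ R hR
  rw [e1, e2] at a1
  rw [abs_le] at a1 a2 ⊢
  constructor <;> linarith

end Asymptotics

end LatticeCount

/-- Lattice point count with smooth homogeneous weight over a dilated
star-shaped body with smooth boundary and nondegenerate second fundamental form. -/
theorem lattice_projection_asymptotics
    (n : ℕ) (hn : 2 ≤ n)
    (g : (Fin n → ℝ) → ℝ)
    (hg_cont : Continuous g)
    (hg_pos : ∀ x : Fin n → ℝ, x ≠ 0 → 0 < g x)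
    (hg_hom : ∀ t : ℝ, 0 < t → ∀ x : Fin n → ℝ, g (t • x) = t * g x)
    (hg_smooth : ContDiffOn ℝ (⊤ : ℕ∞) g {(0 : Fin n → ℝ)}ᶜ)
    (hg_nondeg : ∀ x : Fin n → ℝ, x ≠ 0 → ∀ v : Fin n → ℝ,
      (∀ w : Fin n → ℝ, fderiv ℝ (fun y => fderiv ℝ g y) x v w = 0) ↔ ∃ c : ℝ, v = c • x)
    (f : (Fin n → ℝ) → ℝ)
    (hf_smooth : ContDiffOn ℝ (⊤ : ℕ∞) f {(0 : Fin n → ℝ)}ᶜ)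
    (hf_hom : ∀ t : ℝ, 0 < t → ∀ x : Fin n → ℝ, f (t • x) = f x) :
    ∃ C : ℝ, 0 < C ∧ ∀ L : ℝ, 1 ≤ L →
      |(∑' k : {k : Fin n → ℤ // k ≠ 0 ∧ g (fun i => (k i : ℝ)) < Real.sqrt L},
          f (fun i => ((k : Fin n → ℤ) i : ℝ)))
        - L ^ ((n : ℝ) / 2) * ∫ x in {x : Fin n → ℝ | g x < 1}, f x|
      ≤ C * L ^ ((n : ℝ) / 2 - n / (n + 1)) := by
  obtain ⟨d, rfl⟩ : ∃ d, n = d + 1 := ⟨n - 1, by omega⟩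
  have hg : LatticeCount.IsGauge g := ⟨hg_cont, hg_pos, hg_hom, hg_smooth, hg_nondeg⟩
  obtain ⟨K, hK, h⟩ := hg.latticeSum_asymptotics (by omega) hf_smooth hf_hom
  refine ⟨K + 1, by positivity, fun L hL => ?_⟩
  have hL0 : 0 ≤ L := by linarith
  have e1 : (∑' k : {k : Fin (d + 1) → ℤ // k ≠ 0 ∧ g (fun i => (k i : ℝ)) < Real.sqrt L},
      f (fun i => ((k : Fin (d + 1) → ℤ) i : ℝ))) = LatticeCount.latticeSum g f (Real.sqrt L) :=
    tsum_subtype {k : Fin (d + 1) → ℤ | k ≠ 0 ∧ g (LatticeCount.toReal k) < Real.sqrt L}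
      (fun k => f (LatticeCount.toReal k))
  have e2 : L ^ (((d + 1 : ℕ) : ℝ) / 2) = Real.sqrt L ^ (d + 1) := by
    rw [Real.sqrt_eq_rpow, ← Real.rpow_natCast, ← Real.rpow_mul hL0]
    congr 1; ring
  have e3 : L ^ (((d + 1 : ℕ) : ℝ) / 2 - (d + 1 : ℕ) / ((d + 1 : ℕ) + 1))
      = Real.sqrt L ^ ((d : ℝ) + 1 - 2 * (d + 1) / (d + 2)) := by
    rw [Real.sqrt_eq_rpow, ← Real.rpow_mul hL0]
    congr 1
    push_cast
    field_simp
    ring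
  rw [e1, e2, e3]
  refine (h _ (Real.one_le_sqrt.2 hL)).trans ?_
  gcongr
  linarith
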